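/- arXiv:math/0509045 — 5 statements merged into one kernel-verified Lean document; each statement's English description precedes it below -/
import Mathlib

section
/- Let n > p ≥ 1 with d = n − p > 1. Let g₁,…,g_p be holomorphic on an open neighborhood Ω of 0 in ℂⁿ with g_i(0) = 0, G = (g₁,…,g_p), and assume G^{-1}(0) is a d-dimensional isolated complete intersection singularity: O_n/(g₁,…,g_p) has Krull dimension d and, on some neighborhood of 0, DG(z) is surjective for every z ∈ G^{-1}(0) ∖ {0}. Define the smoothing F(u,b,z) = Σ_{i=1}^p (1 + Σ_{j=1}^n b_{ij} z_j)(g_i(z) − u_i)² and f_{u,b} = F(u,b,·). Then there exist a neighborhood W ⊆ Ω of 0 and a dense open subset U of some neighborhood of 0 in ℂ^p × ℂ^{pn} such that for every (u,b) ∈ U: (i) every critical point z ∈ W of f_{u,b} with G(z) ≠ u is nondegenerate (f_{u,b} has only A₁ singularities off G^{-1}(u)); (ii) DG(z) is surjective at every z ∈ W ∩ G^{-1}(u) (G^{-1}(u) is smooth in W); (iii) at every z ∈ W ∩ G^{-1}(u), f_{u,b} has a singularity of type A(d): there is a biholomorphism φ from a neighborhood of 0 in ℂ^d × ℂ^p onto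 a neighborhood of z with φ(0) = z and f_{u,b}(φ(ζ,ω)) = ω₁² + ⋯ + ω_p². (Lemma 3.10 of the paper.) -/
open Filter Topology

set_option maxHeartbeats 1000000
set_option synthInstance.maxHeartbeats 400000

noncomputable section

/-- `ℂⁿ`. -/
abbrev Cn (n : ℕ) : Type := Fin n → ℂ

/-- `Filter.Germ l ℂ` is a `ℂ`-algebra via constant germs. -/
instance germAlgebra {α : Type*} (l : Filter α) : Algebra ℂ (Filter.Germ l ℂ) :=
  ((Filter.Germ.coeRingHom l).comp (Pi.constRingHom α ℂ)).toAlgebra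

/-- The local ring `O_n` of germs at `0` of holomorphic functions `ℂⁿ → ℂ`,
realized as the subalgebra of `Filter.Germ (𝓝 0) ℂ` consisting of germs
having a representative analytic on a neighborhood of `0`. -/
def On (n : ℕ) : Subalgebra ℂ (Filter.Germ (𝓝 (0 : Cn n)) ℂ) where
  carrier := {φ | ∃ f : Cn n → ℂ, AnalyticAt ℂ f 0 ∧ φ = ↑f}
  mul_mem' := by
    rintro a b ⟨f, hf, rfl⟩ ⟨g, hg, rfl⟩
    exact ⟨f * g, hf.mul hg, rfl⟩
  one_mem' := ⟨1, analyticAt_const, rfl⟩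
  add_mem' := by
    rintro a b ⟨f, hf, rfl⟩ ⟨g, hg, rfl⟩
    exact ⟨f + g, hf.add hg, rfl⟩
  zero_mem' := ⟨0, analyticAt_const, rfl⟩
  algebraMap_mem' := fun c => ⟨fun _ => c, analyticAt_const, rfl⟩

/-- The ideal of `O_n` generated by the germs at `0` of a set of functions. -/
def idealOfFuns {n : ℕ} (s : Set (Cn n → ℂ)) : Ideal (On n) :=
  Ideal.span {x : On n | ∃ f ∈ s, (x : Filter.Germ (𝓝 (0 : Cn n)) ℂ) = ↑f}

/-- The `i`-th partial derivative `∂f/∂zᵢ` of `f : ℂⁿ → ℂ`. -/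
def pder {n : ℕ} (f : Cn n → ℂ) (i : Fin n) : Cn n → ℂ :=
  fun z => fderiv ℂ f z (Pi.single i 1)

/-- The jacobian ideal `J(f)` of `O_n`, generated by the germs at `0` of the
partial derivatives of `f`. -/
def jacobianIdeal {n : ℕ} (f : Cn n → ℂ) : Ideal (On n) :=
  idealOfFuns (Set.range (pder f))

/-- For ideals `J ⊆ I` of `O_n`, the quotient `I/J`, realized as the
`ℂ`-subspace of `O_n ⧸ J` given by the image of `I`. -/
def quotIJ {n : ℕ} (I J : Ideal (On n)) : Submodule ℂ ((On n) ⧸ J) :=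
  (I.map (Ideal.Quotient.mk J)).restrictScalars ℂ

/-- `f` has a singularity of type `A(d)` at `x ∈ ℂⁿ` (with `r = n - d`):
there is a biholomorphism `φ` from a neighborhood of `0` in `ℂ^d × ℂ^r` onto a
neighborhood of `x` with `φ 0 = x` and `f (φ (z, w)) - f x = w₁² + ⋯ + w_r²`. -/
def HasAdSingularityAt (n d r : ℕ) (f : Cn n → ℂ) (x : Cn n) : Prop :=
  ∃ (V : Set ((Fin d → ℂ) × (Fin r → ℂ))) (W : Set (Cn n))
    (φ : (Fin d → ℂ) × (Fin r → ℂ) → Cn n) (ψ : Cn n → (Fin d → ℂ) × (Fin r → ℂ)),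
    IsOpen V ∧ IsOpen W ∧ (0 : (Fin d → ℂ) × (Fin r → ℂ)) ∈ V ∧ x ∈ W ∧
    φ 0 = x ∧ AnalyticOnNhd ℂ φ V ∧ AnalyticOnNhd ℂ ψ W ∧
    Set.MapsTo φ V W ∧ Set.MapsTo ψ W V ∧
    (∀ q ∈ V, ψ (φ q) = q) ∧ (∀ y ∈ W, φ (ψ y) = y) ∧
    ∀ q ∈ V, f (φ q) - f x = ∑ i, (q.2 i) ^ 2

section RegularValues

open MeasureTheory Module

section Straightening

variable {E F : Type*} [NormedAddCommGroup E] [NormedSpace ℂ E] [FiniteDimensional ℂ E]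
  [NormedAddCommGroup F] [NormedSpace ℂ F] [FiniteDimensional ℂ F]

/-- An analytic map with surjective derivative at `x₀` is, in suitable analytic coordinates
near `x₀`, a linear projection. -/
theorem exists_straightening {f : E → F} {x₀ : E} (hf : AnalyticAt ℂ f x₀)
    (hs : Function.Surjective (fderiv ℂ f x₀)) :
    ∃ e : OpenPartialHomeomorph E (F × (fderiv ℂ f x₀).ker), x₀ ∈ e.source ∧
      (∀ x ∈ e.source, (e x).1 = f x) ∧ AnalyticOnNhd ℂ e e.source ∧
      AnalyticOnNhd ℂ e.symm e.target := by
  have : CompleteSpace E := FiniteDimensional.complete ℂ E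
  have : CompleteSpace F := FiniteDimensional.complete ℂ F
  have hker : (fderiv ℂ f x₀).ker.ClosedComplemented :=
    Submodule.ClosedComplemented.of_finiteDimensional _
  have hrange : (fderiv ℂ f x₀).range = ⊤ := LinearMap.range_eq_top.2 hs
  let φ := HasStrictFDerivAt.implicitFunctionDataOfComplemented f (fderiv ℂ f x₀)
    hf.hasStrictFDerivAt hrange hker
  let e := φ.toOpenPartialHomeomorph
  have he : ⇑e = fun x => (f x, Classical.choose hker (x - x₀)) := rfl
  have hx₀ : x₀ ∈ e.source := φ.pt_mem_toOpenPartialHomeomorph_source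
  have hea : AnalyticAt ℂ e x₀ := by
    rw [he]
    exact hf.prod (((Classical.choose hker).analyticAt _).comp
      (analyticAt_id.sub analyticAt_const))
  have hesymm : AnalyticAt ℂ e.symm (e x₀) :=
    e.analyticAt_symm' hx₀ hea φ.hasStrictFDerivAt.hasFDerivAt.fderiv
  let s : Set E := {x | AnalyticAt ℂ e x} ∩ (e.source ∩ e ⁻¹' {q | AnalyticAt ℂ e.symm q})
  have hso : IsOpen s := (isOpen_analyticAt ℂ e).inter
    (e.isOpen_inter_preimage (isOpen_analyticAt ℂ e.symm))
  refine ⟨e.restrOpen s hso, ⟨hx₀, hea, hx₀, hesymm⟩, fun x _ => rfl, fun x hx => hx.2.1, ?_⟩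
  intro q hq
  have h1 := (e.restrOpen s hso).map_target hq
  have h2 := (e.restrOpen s hso).right_inv hq
  have h3 : AnalyticAt ℂ e.symm (e ((e.restrOpen s hso).symm q)) := h1.2.2.2
  have h4 : e ((e.restrOpen s hso).symm q) = q := h2
  rw [h4] at h3
  exact h3

end Straightening

section Null

/-- The image of a set is null as soon as it is locally null. -/
theorem measure_image_null_of_locally_null {α β : Type*} [TopologicalSpace α]
    [SecondCountableTopology α] [MeasurableSpace β] (μ : Measure β) (f : α → β) (A : Set α)
    (h : ∀ x ∈ A, ∃ t ∈ 𝓝 x, μ (f '' (A ∩ t)) = 0) : μ (f '' A) = 0 := by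
  classical
  choose! t ht hμ using h
  obtain ⟨c, hcA, hc, hcov⟩ := TopologicalSpace.countable_cover_nhdsWithin
    (f := t) (s := A) fun x hx => mem_nhdsWithin_of_mem_nhds (ht x hx)
  refine measure_mono_null (t := ⋃ x ∈ c, f '' (A ∩ t x)) ?_
    ((measure_biUnion_null_iff hc).2 fun x hx => hμ x (hcA hx))
  rintro _ ⟨x, hx, rfl⟩
  obtain ⟨y, hy, hxy⟩ := Set.mem_iUnion₂.1 (hcov hx)
  exact Set.mem_iUnion₂.2 ⟨y, hy, x, ⟨hx, hxy⟩, rfl⟩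

end Null

section Sard

variable {E F M : Type*} [NormedAddCommGroup E] [NormedSpace ℂ E] [FiniteDimensional ℂ E]
  [NormedAddCommGroup F] [NormedSpace ℂ F] [FiniteDimensional ℂ F]
  [NormedAddCommGroup M] [NormedSpace ℂ M] [CompleteSpace M]

omit [FiniteDimensional ℂ E] in
/-- An analytic map all of whose iterated derivatives vanish at a point vanishes nearby. -/
theorem AnalyticAt.eventually_eq_zero_of_iteratedFDeriv {m : E → M} {x : E}
    (hm : AnalyticAt ℂ m x) (h : ∀ k, iteratedFDeriv ℂ k m x = 0) : ∀ᶠ y in 𝓝 x, m y = 0 := by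
  obtain ⟨q, r, hq⟩ := hm
  have hb : Metric.eball (0 : E) r ∈ 𝓝 (0 : E) := Metric.eball_mem_nhds _ hq.r_pos
  have ht : Tendsto (fun y => y - x) (𝓝 x) (𝓝 0) := by
    simpa using (continuous_id.sub continuous_const).tendsto (f := fun y : E => y - x) x
  filter_upwards [ht hb] with y hy
  have := hq.hasSum_iteratedFDeriv hy
  have h2 : HasSum (fun _ : ℕ => (0 : M)) (m y) := by simpa [h] using this
  exact h2.unique hasSum_zero

omit [FiniteDimensional ℂ E] in
/-- A zero of an analytic map which is not locally zero is a noncritical zero of some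
iterated derivative. -/
theorem exists_iteratedFDeriv_eq_zero_fderiv_ne_zero {m : E → M} {x : E}
    (hm : AnalyticAt ℂ m x) (hx : m x = 0) (hne : ¬ ∀ᶠ y in 𝓝 x, m y = 0) :
    ∃ k, iteratedFDeriv ℂ k m x = 0 ∧ fderiv ℂ (iteratedFDeriv ℂ k m) x ≠ 0 := by
  classical
  have hex : ∃ k, iteratedFDeriv ℂ k m x ≠ 0 := by
    by_contra! h
    exact hne (hm.eventually_eq_zero_of_iteratedFDeriv h)
  have h0 : Nat.find hex ≠ 0 := by
    intro h
    have := Nat.find_spec hex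
    rw [h] at this
    exact this (by ext; simpa using hx)
  obtain ⟨k, hk⟩ := Nat.exists_eq_succ_of_ne_zero h0
  refine ⟨k, ?_, ?_⟩
  · by_contra hc
    exact Nat.find_min hex (m := k) (by omega) hc
  · intro hc
    have := Nat.find_spec hex
    rw [hk] at this
    apply this
    ext v
    rw [iteratedFDeriv_succ_apply_left, hc]
    simp

omit [FiniteDimensional ℂ E] in
theorem AnalyticAt.iteratedFDeriv_of_analyticAt {m : E → M} {x : E} (hm : AnalyticAt ℂ m x)
    (k : ℕ) : AnalyticAt ℂ (iteratedFDeriv ℂ k m) x := by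
  have h : AnalyticOnNhd ℂ m {y | AnalyticAt ℂ m y} := fun y hy => hy
  exact h.iteratedFDeriv k x hm

variable [MeasurableSpace F] [BorelSpace F] (μ : Measure F) [μ.IsAddHaarMeasure]

/-- The critical values of analytic maps on `E` form a `μ`-null set. -/
def CriticalValuesNull (E : Type*) [NormedAddCommGroup E] [NormedSpace ℂ E]
    {F : Type*} [NormedAddCommGroup F] [NormedSpace ℂ F] [MeasurableSpace F]
    (μ : Measure F) : Prop :=
  ∀ (f : E → F) (A : Set E), (∀ x ∈ A, AnalyticAt ℂ f x) →
    (∀ x ∈ A, ¬ Function.Surjective (fderiv ℂ f x)) → μ (f '' A) = 0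

omit [FiniteDimensional ℂ F] [CompleteSpace M] [BorelSpace F] in
theorem measure_image_null_of_subset_hypersurface {μ : Measure F}
    (IH : ∀ K : Submodule ℂ E, finrank ℂ K < finrank ℂ E → CriticalValuesNull K μ)
    {f : E → F} {A : Set E} (hf : ∀ x ∈ A, AnalyticAt ℂ f x)
    (hs : ∀ x ∈ A, ¬ Function.Surjective (fderiv ℂ f x)) {w : E → M}
    (hw : ∀ x ∈ A, AnalyticAt ℂ w x) (hw0 : ∀ x ∈ A, w x = 0)
    (hw' : ∀ x ∈ A, fderiv ℂ w x ≠ 0) : μ (f '' A) = 0 := by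
  have : CompleteSpace E := FiniteDimensional.complete ℂ E
  have : ProperSpace E := FiniteDimensional.proper ℂ E
  refine measure_image_null_of_locally_null μ f A fun x₀ hx₀ => ?_
  obtain ⟨v, hv⟩ : ∃ v, fderiv ℂ w x₀ v ≠ 0 := by
    by_contra! h
    exact hw' x₀ hx₀ (ContinuousLinearMap.ext h)
  obtain ⟨l, hl⟩ := SeparatingDual.exists_ne_zero (R := ℂ) hv
  have hla : AnalyticAt ℂ (fun x => l (w x)) x₀ := (l.analyticAt _).comp (hw x₀ hx₀)
  have hld : fderiv ℂ (fun x => l (w x)) x₀ = l.comp (fderiv ℂ w x₀) :=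
    (l.hasFDerivAt.comp x₀ (hw x₀ hx₀).differentiableAt.hasFDerivAt).fderiv
  have hne : fderiv ℂ (fun x => l (w x)) x₀ v ≠ 0 := by rw [hld]; exact hl
  have hsurj : Function.Surjective (fderiv ℂ (fun x => l (w x)) x₀) := fun c =>
    ⟨(c / fderiv ℂ (fun x => l (w x)) x₀ v) • v, by
      rw [map_smul, smul_eq_mul, div_mul_cancel₀ _ hne]⟩
  obtain ⟨e, hxe, he1, -, hesymm⟩ := exists_straightening hla hsurj
  refine ⟨e.source, e.open_source.mem_nhds hxe, ?_⟩
  let K := (fderiv ℂ (fun x => l (w x)) x₀).ker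
  have hK : finrank ℂ K < finrank ℂ E := by
    refine Submodule.finrank_lt fun h => hne ?_
    have hvK : v ∈ K := h ▸ Submodule.mem_top
    exact hvK
  let s : K → E := fun k => e.symm (0, k)
  let A' : Set K := {k | ((0 : ℂ), k) ∈ e.target ∧ s k ∈ A}
  have hsa : ∀ k ∈ A', AnalyticAt ℂ s k := fun k hk =>
    AnalyticAt.comp (x := k) (f := fun k : K => ((0 : ℂ), k)) (hesymm (0, k) hk.1)
      (analyticAt_const.prod analyticAt_id)
  refine measure_mono_null ?_ (IH K hK (f ∘ s) A'
    (fun k hk => (hf _ hk.2).comp (hsa k hk)) fun k hk hsur => hs _ hk.2 ?_)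
  · rintro _ ⟨x, ⟨hxA, hxs⟩, rfl⟩
    have hex : e x = (0, (e x).2) := Prod.ext (by rw [he1 x hxs, hw0 x hxA, map_zero]) rfl
    have hsx : s (e x).2 = x := by
      change e.symm (0, (e x).2) = x
      rw [← hex, e.left_inv hxs]
    refine ⟨(e x).2, ⟨?_, ?_⟩, ?_⟩
    · rw [← hex]; exact e.map_source hxs
    · rw [hsx]; exact hxA
    · rw [Function.comp_apply, hsx]
  · rw [fderiv_comp k (hf _ hk.2).differentiableAt (hsa k hk).differentiableAt] at hsur
    exact Function.Surjective.of_comp hsur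

omit [FiniteDimensional ℂ F] [BorelSpace F] in
theorem measure_image_null_of_subset_zeros {μ : Measure F}
    (IH : ∀ K : Submodule ℂ E, finrank ℂ K < finrank ℂ E → CriticalValuesNull K μ)
    {f : E → F} {A : Set E} (hf : ∀ x ∈ A, AnalyticAt ℂ f x)
    (hs : ∀ x ∈ A, ¬ Function.Surjective (fderiv ℂ f x)) {m : E → M} {x₀ : E}
    (hm : AnalyticAt ℂ m x₀) (hne : ¬ ∀ᶠ x in 𝓝 x₀, m x = 0)
    (hm0 : ∀ᶠ x in 𝓝 x₀, x ∈ A → m x = 0) : ∃ t ∈ 𝓝 x₀, μ (f '' (A ∩ t)) = 0 := by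
  have : CompleteSpace E := FiniteDimensional.complete ℂ E
  obtain ⟨ε, hε, hball⟩ := Metric.eventually_nhds_iff_ball.1 (hm.eventually_analyticAt.and hm0)
  refine ⟨Metric.ball x₀ ε, Metric.ball_mem_nhds _ hε, ?_⟩
  have hne' : ∀ x ∈ Metric.ball x₀ ε, ¬ ∀ᶠ y in 𝓝 x, m y = 0 := fun x hx h => hne <| by
    have hma : AnalyticOnNhd ℂ m (Metric.ball x₀ ε) := fun y hy => (hball y hy).1
    have hpre : IsPreconnected (Metric.ball x₀ ε) := by
      let _ : NormedSpace ℝ E := NormedSpace.restrictScalars ℝ ℂ E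
      exact (convex_ball x₀ ε).isPreconnected
    have := hma.eqOn_zero_of_preconnected_of_eventuallyEq_zero hpre hx h
    filter_upwards [Metric.ball_mem_nhds x₀ hε] with y hy using this hy
  let Z : ℕ → Set E := fun k => {x | x ∈ A ∩ Metric.ball x₀ ε ∧ iteratedFDeriv ℂ k m x = 0 ∧
    fderiv ℂ (iteratedFDeriv ℂ k m) x ≠ 0}
  refine measure_mono_null (t := ⋃ k, f '' Z k) ?_ (measure_iUnion_null fun k => ?_)
  · rintro _ ⟨x, hx, rfl⟩
    obtain ⟨k, hk⟩ := exists_iteratedFDeriv_eq_zero_fderiv_ne_zero (hball x hx.2).1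
      ((hball x hx.2).2 hx.1) (hne' x hx.2)
    exact Set.mem_iUnion.2 ⟨k, x, ⟨hx, hk⟩, rfl⟩
  · exact measure_image_null_of_subset_hypersurface IH (fun x hx => hf x hx.1.1)
      (fun x hx => hs x hx.1.1)
      (fun x hx => (hball x hx.1.2).1.iteratedFDeriv_of_analyticAt k) (fun x hx => hx.2.1)
      (fun x hx => hx.2.2)

/-- Constant rank case of the Morse–Sard theorem: `h` does not depend on its second variable. -/
theorem measure_image_null_of_fderiv_inr_eq_zero {K : Type*} [NormedAddCommGroup K]
    [NormedSpace ℂ K] {R : Submodule ℂ F} (hR : R ≠ ⊤) {h : R × K → F} {q₀ : R × K}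
    (hh : ∀ᶠ q in 𝓝 q₀, DifferentiableAt ℂ h q ∧
      (fderiv ℂ h q).comp (ContinuousLinearMap.inr ℂ R K) = 0) :
    ∃ t ∈ 𝓝 q₀, μ (h '' t) = 0 := by
  obtain ⟨ε, hε, hball⟩ := Metric.eventually_nhds_iff_ball.1 hh
  obtain ⟨a₀, k₀⟩ := q₀
  simp_rw [← ball_prod_same] at hball
  refine ⟨Metric.ball a₀ ε ×ˢ Metric.ball k₀ ε, by
    rw [ball_prod_same]; exact Metric.ball_mem_nhds _ hε, ?_⟩
  obtain ⟨π, hπ⟩ := Submodule.ClosedComplemented.of_finiteDimensional R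
  have hk₀ : k₀ ∈ Metric.ball k₀ ε := Metric.mem_ball_self hε
  have hconst : ∀ a ∈ Metric.ball a₀ ε, ∀ k ∈ Metric.ball k₀ ε, h (a, k) = h (a, k₀) := by
    intro a ha k hk
    have hd : ∀ y ∈ Metric.ball k₀ ε, HasFDerivAt (fun y => h (a, y)) (0 : K →L[ℂ] F) y := by
      intro y hy
      have := hball (a, y) ⟨ha, hy⟩
      rw [← this.2]
      exact this.1.hasFDerivAt.comp y (hasFDerivAt_prodMk_right a y)
    let _ : NormedSpace ℝ K := NormedSpace.restrictScalars ℝ ℂ K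
    exact Metric.isOpen_ball.is_const_of_fderiv_eq_zero (𝕜 := ℂ) (f := fun y => h (a, y))
      (convex_ball k₀ ε).isPreconnected
      (fun y hy => (hd y hy).differentiableAt.differentiableWithinAt)
      (fun y hy => (hd y hy).fderiv) hk hk₀
  have hsub : h '' (Metric.ball a₀ ε ×ˢ Metric.ball k₀ ε) ⊆
      (fun y : F => h (π y, k₀)) '' ((R : Set F) ∩ {y | π y ∈ Metric.ball a₀ ε}) := by
    rintro _ ⟨⟨a, k⟩, ⟨ha, hk⟩, rfl⟩
    refine ⟨a, ⟨a.2, ?_⟩, ?_⟩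
    · change π a ∈ Metric.ball a₀ ε
      rw [hπ a]; exact ha
    · change h (π a, k₀) = h (a, k)
      rw [hπ a, hconst a ha k hk]
  refine measure_mono_null hsub
    (addHaar_image_eq_zero_of_differentiableOn_of_addHaar_eq_zero μ (fun y hy => ?_)
      (measure_mono_null Set.inter_subset_left
        (Measure.addHaar_submodule μ (R.restrictScalars ℝ) (by simpa using hR))))
  have h1 : DifferentiableAt ℂ h (π y, k₀) := (hball (π y, k₀) ⟨hy.2, hk₀⟩).1
  have h2 : DifferentiableAt ℂ (fun y : F => h (π y, k₀)) y :=
    h1.comp y (π.differentiableAt.prodMk (differentiableAt_const k₀))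
  exact (h2.restrictScalars ℝ).differentiableWithinAt

theorem criticalValuesNull_of_submodule
    (IH : ∀ K : Submodule ℂ E, finrank ℂ K < finrank ℂ E → CriticalValuesNull K μ) :
    CriticalValuesNull E μ := by
  intro f A hf hs
  have : CompleteSpace E := FiniteDimensional.complete ℂ E
  have : CompleteSpace F := FiniteDimensional.complete ℂ F
  have : ProperSpace E := FiniteDimensional.proper ℂ E
  let S : ℕ → Set E := fun r => {x | x ∈ A ∧ finrank ℂ (fderiv ℂ f x).range = r}
  refine measure_mono_null (t := ⋃ r, f '' S r) ?_ (measure_iUnion_null fun r =>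
    measure_image_null_of_locally_null μ f (S r) fun x₀ hx₀ => ?_)
  · rintro _ ⟨x, hx, rfl⟩
    exact Set.mem_iUnion.2 ⟨_, x, ⟨hx, rfl⟩, rfl⟩
  set R := (fderiv ℂ f x₀).range
  obtain ⟨π, hπ⟩ := Submodule.ClosedComplemented.of_finiteDimensional R
  have hga : AnalyticAt ℂ (fun x => π (f x)) x₀ := (π.analyticAt _).comp (hf x₀ hx₀.1)
  have hgd : fderiv ℂ (fun x => π (f x)) x₀ = π.comp (fderiv ℂ f x₀) :=
    (π.hasFDerivAt.comp x₀ (hf x₀ hx₀.1).differentiableAt.hasFDerivAt).fderiv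
  have hsurj : Function.Surjective (fderiv ℂ (fun x => π (f x)) x₀) := by
    rintro ⟨_, v, rfl⟩
    refine ⟨v, ?_⟩
    rw [hgd]
    exact hπ ⟨_, v, rfl⟩
  obtain ⟨e, hxe, he1, hea, hesymm⟩ := exists_straightening hga hsurj
  let K := (fderiv ℂ (fun x => π (f x)) x₀).ker
  let h : R × K → F := f ∘ e.symm
  have hha : ∀ x ∈ e.source, AnalyticAt ℂ f x → AnalyticAt ℂ h (e x) := fun x hx hfx =>
    AnalyticAt.comp (by rwa [e.left_inv hx]) (hesymm _ (e.map_source hx))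
  let m : E → (K →L[ℂ] F) := fun x => (fderiv ℂ h (e x)).comp (ContinuousLinearMap.inr ℂ R K)
  by_cases H : ∀ᶠ x in 𝓝 x₀, m x = 0
  · have hR : R ≠ ⊤ := fun h => hs x₀ hx₀.1 (LinearMap.range_eq_top.1 h)
    have hev : ∀ᶠ q in 𝓝 (e x₀), DifferentiableAt ℂ h q ∧
        (fderiv ℂ h q).comp (ContinuousLinearMap.inr ℂ R K) = 0 := by
      have hc : Tendsto e.symm (𝓝 (e x₀)) (𝓝 x₀) := e.tendsto_symm hxe
      filter_upwards [hc H, (hha x₀ hxe (hf x₀ hx₀.1)).eventually_analyticAt,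
        e.open_target.mem_nhds (e.map_source hxe)] with q hq hqa hqt
      refine ⟨hqa.differentiableAt, ?_⟩
      have : m (e.symm q) = 0 := hq
      simpa only [m, e.right_inv hqt] using this
    obtain ⟨t, ht, hμ⟩ := measure_image_null_of_fderiv_inr_eq_zero μ hR hev
    refine ⟨e.source ∩ e ⁻¹' t, inter_mem (e.open_source.mem_nhds hxe)
      ((e.continuousAt hxe).preimage_mem_nhds ht), measure_mono_null ?_ hμ⟩
    rintro _ ⟨x, ⟨-, hx, hxt⟩, rfl⟩
    exact ⟨e x, hxt, by simp only [h, Function.comp_apply, e.left_inv hx]⟩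
  · have hma : AnalyticAt ℂ m x₀ := by
      have h1 : AnalyticAt ℂ (fun x => fderiv ℂ h (e x)) x₀ :=
        AnalyticAt.comp (hha x₀ hxe (hf x₀ hx₀.1)).fderiv (hea x₀ hxe)
      exact ((((ContinuousLinearMap.compL ℂ K (R × K) F).flip
        (ContinuousLinearMap.inr ℂ R K)).analyticAt _).comp h1)
    refine measure_image_null_of_subset_zeros IH (fun x hx => hf x hx.1) (fun x hx => hs x hx.1)
      hma H ?_
    filter_upwards [e.open_source.mem_nhds hxe] with x hx hxS
    have hfx := hf x hxS.1
    have hes : HasFDerivAt e.symm (fderiv ℂ e.symm (e x)) (e x) :=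
      (hesymm _ (e.map_source hx)).differentiableAt.hasFDerivAt
    have hfx' : HasFDerivAt f (fderiv ℂ f x) (e.symm (e x)) := by
      rw [e.left_inv hx]; exact hfx.differentiableAt.hasFDerivAt
    have hhd : HasFDerivAt h ((fderiv ℂ f x).comp (fderiv ℂ e.symm (e x))) (e x) :=
      hfx'.comp (e x) hes
    have hfst : (π.comp ((fderiv ℂ f x).comp (fderiv ℂ e.symm (e x)))) =
        ContinuousLinearMap.fst ℂ R K := by
      refine HasFDerivAt.unique (f := fun q => π (h q)) (x := e x) (π.hasFDerivAt.comp (e x) hhd)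
        ((hasFDerivAt_fst (𝕜 := ℂ) (p := e x)).congr_of_eventuallyEq ?_)
      filter_upwards [e.open_target.mem_nhds (e.map_source hx)] with q hq
      have := he1 _ (e.map_target hq)
      rw [e.right_inv hq] at this
      exact this.symm
    have hTs : Function.Surjective (π.toLinearMap.domRestrict (fderiv ℂ f x).range) := by
      intro a
      refine ⟨⟨fderiv ℂ f x (fderiv ℂ e.symm (e x) (a, 0)), _, rfl⟩, ?_⟩
      exact congrArg (fun L : R × K →L[ℂ] R => L (a, 0)) hfst
    have hTi : Function.Injective (π.toLinearMap.domRestrict (fderiv ℂ f x).range) :=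
      (LinearMap.injective_iff_surjective_of_finrank_eq_finrank (hxS.2.trans hx₀.2.symm)).2 hTs
    ext k
    change fderiv ℂ h (e x) (0, k) = 0
    rw [hhd.fderiv]
    have hz : (⟨fderiv ℂ f x (fderiv ℂ e.symm (e x) (0, k)), _, rfl⟩ :
        (fderiv ℂ f x).range) = 0 := by
      refine hTi ?_
      rw [map_zero]
      exact congrArg (fun L : R × K →L[ℂ] R => L (0, k)) hfst
    exact congrArg Subtype.val hz

end Sard

section Sard

universe u

variable {F : Type*} [NormedAddCommGroup F] [NormedSpace ℂ F] [FiniteDimensional ℂ F]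
  [MeasurableSpace F] [BorelSpace F] (μ : Measure F) [μ.IsAddHaarMeasure]

/-- **Morse–Sard theorem** for analytic maps between finite-dimensional complex spaces. -/
theorem criticalValuesNull (E : Type u) [NormedAddCommGroup E] [NormedSpace ℂ E]
    [FiniteDimensional ℂ E] : CriticalValuesNull E μ := by
  induction hn : finrank ℂ E using Nat.strong_induction_on generalizing E with
  | _ n ih => exact criticalValuesNull_of_submodule μ fun K hK => ih _ (hn ▸ hK) K rfl

/-- **Parametric Sard theorem**: for almost every parameter `p`, `0` is a regular value of
`Φ (·, p)` provided it is a regular value of the analytic map `Φ`. -/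
theorem measure_snd_image_null {Z V : Type*} [NormedAddCommGroup Z] [NormedSpace ℂ Z]
    [FiniteDimensional ℂ Z] [NormedAddCommGroup V] [NormedSpace ℂ V] [FiniteDimensional ℂ V]
    {Φ : Z × F → V} {A : Set (Z × F)} (hΦ : ∀ x ∈ A, AnalyticAt ℂ Φ x) (hΦ0 : ∀ x ∈ A, Φ x = 0)
    (hs : ∀ x ∈ A, Function.Surjective (fderiv ℂ Φ x))
    (hns : ∀ x ∈ A, ¬ Function.Surjective
      ((fderiv ℂ Φ x).comp (ContinuousLinearMap.inl ℂ Z F))) :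
    μ (Prod.snd '' A) = 0 := by
  have : ProperSpace (Z × F) := FiniteDimensional.proper ℂ (Z × F)
  refine measure_image_null_of_locally_null μ Prod.snd A fun x₀ hx₀ => ?_
  obtain ⟨e, hxe, he1, -, hesymm⟩ := exists_straightening (hΦ x₀ hx₀) (hs x₀ hx₀)
  refine ⟨e.source, e.open_source.mem_nhds hxe, ?_⟩
  let K := (fderiv ℂ Φ x₀).ker
  let s : K → Z × F := fun k => e.symm (0, k)
  let A' : Set K := {k | ((0 : V), k) ∈ e.target ∧ s k ∈ A}
  have hsa : ∀ k : K, ((0 : V), k) ∈ e.target → AnalyticAt ℂ s k := fun k hk =>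
    AnalyticAt.comp (x := k) (f := fun k : K => ((0 : V), k)) (hesymm (0, k) hk)
      (analyticAt_const.prod analyticAt_id)
  refine measure_mono_null ?_ (criticalValuesNull μ K (fun k => (s k).2) A'
    (fun k hk => analyticAt_snd.comp (hsa k hk.1)) fun k hk hsur => hns _ hk.2 fun v => ?_)
  · rintro _ ⟨x, ⟨hxA, hxs⟩, rfl⟩
    have hex : e x = (0, (e x).2) := Prod.ext (by rw [he1 x hxs, hΦ0 x hxA]) rfl
    have hsx : s (e x).2 = x := by
      change e.symm (0, (e x).2) = x
      rw [← hex, e.left_inv hxs]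
    exact ⟨(e x).2, ⟨by rw [← hex]; exact e.map_source hxs, by rwa [hsx]⟩, by simp only [hsx]⟩
  · have hsd : HasFDerivAt s (fderiv ℂ s k) k := (hsa k hk.1).differentiableAt.hasFDerivAt
    have h0 : (fderiv ℂ Φ (s k)).comp (fderiv ℂ s k) = 0 := by
      refine HasFDerivAt.unique (f := fun k => Φ (s k)) (x := k)
        ((hΦ _ hk.2).differentiableAt.hasFDerivAt.comp k hsd)
        ((hasFDerivAt_const (0 : V) k).congr_of_eventuallyEq ?_)
      have hc : ContinuousAt (fun k : K => ((0 : V), k)) k := by fun_prop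
      filter_upwards [hc.preimage_mem_nhds (e.open_target.mem_nhds hk.1)] with k' hk'
      have := he1 _ (e.map_target hk')
      rw [e.right_inv hk'] at this
      exact this.symm
    have hsd2 : fderiv ℂ (fun k => (s k).2) k =
        (ContinuousLinearMap.snd ℂ Z F).comp (fderiv ℂ s k) := (hasFDerivAt_snd.comp k hsd).fderiv
    rw [hsd2] at hsur
    obtain ⟨⟨a, c⟩, rfl⟩ := hs _ hk.2 v
    obtain ⟨κ, hκ⟩ := hsur c
    refine ⟨a - (fderiv ℂ s k κ).1, ?_⟩
    have h1 : fderiv ℂ Φ (s k) (fderiv ℂ s k κ) = 0 :=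
      congrArg (fun L : K →L[ℂ] V => L κ) h0
    have h2 : ((a - (fderiv ℂ s k κ).1, 0) : Z × F) = (a, c) - fderiv ℂ s k κ :=
      Prod.ext rfl (by rw [← hκ]; simp)
    change fderiv ℂ Φ (s k) (a - (fderiv ℂ s k κ).1, 0) = _
    rw [h2, map_sub, h1, sub_zero]

end Sard

section Covector

variable {n : ℕ}

/-- The covector `v ↦ ∑ j, β j * v j` on `ℂⁿ`. -/
def covector : (Fin n → ℂ) →L[ℂ] Cn n →L[ℂ] ℂ :=
  ∑ j, (ContinuousLinearMap.proj (R := ℂ) (φ := fun _ : Fin n => ℂ) j).smulRight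
    (ContinuousLinearMap.proj (R := ℂ) (φ := fun _ : Fin n => ℂ) j)

theorem covector_apply (β : Fin n → ℂ) (v : Cn n) : covector β v = ∑ j, β j * v j := by
  simp [covector]

theorem covector_single (η : Cn n →L[ℂ] ℂ) : covector (fun j => η (Pi.single j 1)) = η := by
  ext v
  rw [covector_apply]
  conv_rhs => rw [← Finset.univ_sum_single v, map_sum]
  refine Finset.sum_congr rfl fun j _ => ?_
  have : (Pi.single j (v j) : Cn n) = v j • Pi.single j 1 := by
    rw [← Pi.single_smul, smul_eq_mul, mul_one]
  rw [this, map_smul, smul_eq_mul, mul_comm]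

end Covector

section LinearAlgebra

theorem surjective_pi_iff_linearIndependent {ι E : Type*} [Fintype ι] [NormedAddCommGroup E]
    [NormedSpace ℂ E] (L : ι → E →L[ℂ] ℂ) :
    Function.Surjective (ContinuousLinearMap.pi L) ↔ LinearIndependent ℂ L := by
  classical
  rw [Fintype.linearIndependent_iff]
  refine ⟨fun h c hc i => ?_, fun h => ?_⟩
  · obtain ⟨v, hv⟩ := h (Pi.single i 1)
    have hv' : ∀ k, L k v = (Pi.single i 1 : ι → ℂ) k := fun k => congrFun hv k
    have := congrArg (fun T : E →L[ℂ] ℂ => T v) hc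
    simpa [sum_apply, hv', Pi.single_apply] using this
  · by_contra hs
    have hlt : (ContinuousLinearMap.pi L).range < ⊤ :=
      lt_top_iff_ne_top.2 fun h => hs (LinearMap.range_eq_top.1 h)
    obtain ⟨f, hf0, hf⟩ := Submodule.exists_le_ker_of_lt_top _ hlt
    apply hf0
    have hsum : ∀ y : ι → ℂ, f y = ∑ i, f (Pi.single i 1) * y i := fun y => by
      conv_lhs => rw [← Finset.univ_sum_single y, map_sum]
      refine Finset.sum_congr rfl fun j _ => ?_
      have : (Pi.single j (y j) : ι → ℂ) = y j • Pi.single j 1 := by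
        rw [← Pi.single_smul, smul_eq_mul, mul_one]
      rw [this, map_smul, smul_eq_mul, mul_comm]
    have hc := h (fun i => f (Pi.single i 1)) <| by
      ext v
      have hv : f (ContinuousLinearMap.pi L v) = 0 := hf ⟨v, rfl⟩
      rw [hsum] at hv
      simpa [sum_apply] using hv
    ext i
    simpa using hc i

end LinearAlgebra

section Smoothing

variable {n p : ℕ}

/-- The parameter space `ℂ^p × ℂ^{pn}` of the smoothing. -/
abbrev SmoothingParam (n p : ℕ) : Type := (Fin p → ℂ) × (Fin p → Fin n → ℂ)

/-- The smoothing `∑ i, (1 + ∑ j, b i j * z j) * (g i z - u i) ^ 2`. -/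
def smoothing (g : Fin p → Cn n → ℂ) (q : SmoothingParam n p) (z : Cn n) : ℂ :=
  ∑ i, (1 + covector (q.2 i) z) * (g i z - q.1 i) ^ 2

/-- The covectors whose combination with coefficients `g i z - u i` is the differential of the
smoothing. -/
def smoothingCovector (g : Fin p → Cn n → ℂ) (q : SmoothingParam n p) (z : Cn n) (i : Fin p) :
    Cn n →L[ℂ] ℂ :=
  (2 * (1 + covector (q.2 i) z)) • fderiv ℂ (g i) z + (g i z - q.1 i) • covector (q.2 i)

theorem fderiv_smoothing {g : Fin p → Cn n → ℂ} {z : Cn n} (hg : ∀ i, DifferentiableAt ℂ (g i) z)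
    (q : SmoothingParam n p) :
    fderiv ℂ (smoothing g q) z = ∑ i, (g i z - q.1 i) • smoothingCovector g q z i := by
  have : HasFDerivAt (smoothing g q) (∑ i, (g i z - q.1 i) • smoothingCovector g q z i) z := by
    refine HasFDerivAt.fun_sum fun i _ => ?_
    have h1 : HasFDerivAt (fun z => 1 + covector (q.2 i) z) (covector (q.2 i)) z :=
      (covector (q.2 i)).hasFDerivAt.const_add 1
    have h2 : HasFDerivAt (fun z => g i z - q.1 i) (fderiv ℂ (g i) z) z :=
      (hg i).hasFDerivAt.sub_const _
    refine (h1.mul (h2.pow 2)).congr_fderiv ?_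
    ext v
    simp [smoothingCovector]
    ring
  exact this.fderiv

theorem analyticAt_smoothing_uncurry {g : Fin p → Cn n → ℂ} {z : Cn n}
    (hg : ∀ i, AnalyticAt ℂ (g i) z) (q : SmoothingParam n p) :
    AnalyticAt ℂ (fun x : Cn n × SmoothingParam n p => smoothing g x.2 x.1) (z, q) := by
  unfold smoothing
  refine Finset.analyticAt_fun_sum _ fun i _ => ?_
  have hproj2 : AnalyticAt ℂ (fun x : Cn n × SmoothingParam n p => x.2.2 i) (z, q) :=
    ContinuousLinearMap.analyticAt
      (((ContinuousLinearMap.proj (R := ℂ) (φ := fun _ : Fin p => Fin n → ℂ) i).comp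
        (ContinuousLinearMap.snd ℂ (Fin p → ℂ) (Fin p → Fin n → ℂ))).comp
          (ContinuousLinearMap.snd ℂ (Cn n) (SmoothingParam n p))) _
  have hproj1 : AnalyticAt ℂ (fun x : Cn n × SmoothingParam n p => x.2.1 i) (z, q) :=
    ContinuousLinearMap.analyticAt
      (((ContinuousLinearMap.proj (R := ℂ) (φ := fun _ : Fin p => ℂ) i).comp
        (ContinuousLinearMap.fst ℂ (Fin p → ℂ) (Fin p → Fin n → ℂ))).comp
          (ContinuousLinearMap.snd ℂ (Cn n) (SmoothingParam n p))) _
  have hgi : AnalyticAt ℂ (fun x : Cn n × SmoothingParam n p => g i x.1) (z, q) :=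
    AnalyticAt.comp (x := (z, q)) (f := Prod.fst) (hg i) analyticAt_fst
  have hc : AnalyticAt ℂ (fun x : Cn n × SmoothingParam n p => covector (x.2.2 i) x.1) (z, q) :=
    AnalyticAt.comp (g := fun y : (Fin n → ℂ) × Cn n => covector y.1 y.2)
      (f := fun x : Cn n × SmoothingParam n p => (x.2.2 i, x.1))
      (covector.analyticAt_bilinear _) (hproj2.prod analyticAt_fst)
  exact (analyticAt_const.add hc).mul ((hgi.sub hproj1).pow 2)

/-- The differential of the smoothing as a function of the point and the parameters. -/
def smoothingDifferential (g : Fin p → Cn n → ℂ) (x : Cn n × SmoothingParam n p) :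
    Cn n →L[ℂ] ℂ :=
  fderiv ℂ (smoothing g x.2) x.1

theorem analyticAt_smoothingDifferential {g : Fin p → Cn n → ℂ} {z : Cn n}
    (hg : ∀ i, AnalyticAt ℂ (g i) z) (q : SmoothingParam n p) :
    AnalyticAt ℂ (smoothingDifferential g) (z, q) := by
  have h := analyticAt_smoothing_uncurry hg q
  have h1 : AnalyticAt ℂ (fun x : Cn n × SmoothingParam n p =>
      (fderiv ℂ (fun x : Cn n × SmoothingParam n p => smoothing g x.2 x.1) x).comp
        (ContinuousLinearMap.inl ℂ (Cn n) (SmoothingParam n p))) (z, q) :=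
    (((ContinuousLinearMap.compL ℂ (Cn n) (Cn n × SmoothingParam n p) ℂ).flip
      (ContinuousLinearMap.inl ℂ _ _)).analyticAt _).comp h.fderiv
  refine h1.congr ?_
  filter_upwards [h.eventually_analyticAt] with x hx
  exact (HasFDerivAt.comp (g := fun x : Cn n × SmoothingParam n p => smoothing g x.2 x.1) x.1
    hx.differentiableAt.hasFDerivAt (hasFDerivAt_prodMk_left (𝕜 := ℂ) x.1 x.2)).fderiv.symm

theorem surjective_fderiv_smoothingDifferential {g : Fin p → Cn n → ℂ} {z : Cn n}
    {q : SmoothingParam n p} (hg : ∀ i, AnalyticAt ℂ (g i) z) {i : Fin p} (hi : g i z ≠ q.1 i)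
    (hz : 1 - covector (q.2 i) z ≠ 0) :
    Function.Surjective (fderiv ℂ (smoothingDifferential g) (z, q)) := by
  intro η
  set w := g i z - q.1 i with hw_def
  have hw : w ≠ 0 := sub_ne_zero.2 hi
  set b := q.2 i with hb
  let s : ℂ := η z / (w * (1 - covector b z))
  let β : Fin n → ℂ := (w ^ 2)⁻¹ • ((fun j => η (Pi.single j 1)) + (2 * s * w) • b)
  have hβ : covector β = (w ^ 2)⁻¹ • (η + (2 * s * w) • covector b) := by
    simp only [β, map_smul, map_add, covector_single]
  refine ⟨(0, (Pi.single i s, Pi.single i β)), ?_⟩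
  let γ : ℂ → Cn n × SmoothingParam n p := fun t =>
    (z, q) + t • (0, (Pi.single i s, Pi.single i β))
  have hγ : HasDerivAt γ (0, (Pi.single i s, Pi.single i β)) 0 :=
    (((hasDerivAt_id (0 : ℂ)).smul_const
      ((0, (Pi.single i s, Pi.single i β)) : Cn n × SmoothingParam n p)).const_add
        (z, q)).congr_deriv (one_smul _ _)
  have hd : HasFDerivAt (smoothingDifferential g) (fderiv ℂ (smoothingDifferential g) (z, q))
      (γ 0) := by
    have : γ 0 = (z, q) := by simp [γ]
    rw [this]
    exact (analyticAt_smoothingDifferential hg q).differentiableAt.hasFDerivAt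
  have h1 := hd.comp_hasDerivAt (0 : ℂ) hγ
  refine h1.unique ?_
  have heq : smoothingDifferential g ∘ γ = fun t =>
      (w - t * s) • ((2 * (1 + covector b z + t * covector β z)) • fderiv ℂ (g i) z +
        (w - t * s) • (covector b + t • covector β)) +
      ∑ k ∈ Finset.univ.erase i, (g k z - q.1 k) • smoothingCovector g q z k := by
    funext t
    have hγ1 : (γ t).1 = z := by simp [γ]
    have hγu : ∀ k, (γ t).2.1 k = q.1 k + t * (Pi.single i s : Fin p → ℂ) k := fun k => rfl
    have hγb : ∀ k, (γ t).2.2 k = q.2 k + t • (Pi.single i β : Fin p → Fin n → ℂ) k :=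
      fun k => rfl
    rw [Function.comp_apply, smoothingDifferential, hγ1,
      fderiv_smoothing fun i => (hg i).differentiableAt, ← Finset.add_sum_erase _ _
      (Finset.mem_univ i)]
    congr 1
    · have hu : (γ t).2.1 i = q.1 i + t * s := by rw [hγu, Pi.single_eq_same]
      have hb' : (γ t).2.2 i = b + t • β := by rw [hγb, Pi.single_eq_same]
      have hw' : g i z - (q.1 i + t * s) = w - t * s := by rw [hw_def]; ring
      have hc : covector b z + t * covector β z = (covector b + t • covector β) z := by simp
      rw [smoothingCovector, hu, hb', hw', map_add, map_smul, add_assoc 1, hc]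
    · refine Finset.sum_congr rfl fun k hk => ?_
      have hki : k ≠ i := Finset.ne_of_mem_erase hk
      have hu : (γ t).2.1 k = q.1 k := by rw [hγu, Pi.single_eq_of_ne hki, mul_zero, add_zero]
      have hb' : (γ t).2.2 k = q.2 k := by rw [hγb, Pi.single_eq_of_ne hki, smul_zero, add_zero]
      rw [smoothingCovector, smoothingCovector, hu, hb']
  rw [heq]
  have hid := hasDerivAt_id (0 : ℂ)
  have hA : HasDerivAt (fun t : ℂ => w - t * s) (-s) 0 := by
    simpa using (hid.mul_const s).const_sub w
  have hB : HasDerivAt (fun t : ℂ => 2 * (1 + covector b z + t * covector β z))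
      (2 * covector β z) 0 := by
    simpa using ((hid.mul_const (covector β z)).const_add (1 + covector b z)).const_mul 2
  have hC : HasDerivAt (fun t : ℂ => covector b + t • covector β) (covector β) 0 := by
    simpa using (hid.smul_const (covector β)).const_add (covector b)
  refine ((hA.smul ((hB.smul_const (fderiv ℂ (g i) z)).add (hA.smul hC))).add_const
    _).congr_deriv ?_
  have hβz : covector β z = (w ^ 2)⁻¹ * (η z + (2 * s * w) * covector b z) := by simp [hβ, mul_add]
  have hs : s * (w * (1 - covector b z)) = η z := div_mul_cancel₀ _ (mul_ne_zero hw hz)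
  have hcoef : w * (2 * covector β z) - s * (2 * (1 + covector b z)) = 0 := by
    rw [hβz, ← hs]
    field_simp
    ring
  ext v
  have hβv : covector β v = (w ^ 2)⁻¹ * (η v + (2 * s * w) * covector b v) := by simp [hβ, mul_add]
  have hmain : w ^ 2 * covector β v = η v + 2 * s * w * covector b v := by
    rw [hβv]; field_simp
  simp
  linear_combination hmain + hcoef * fderiv ℂ (g i) z v

/-- The Hessian matrix of the smoothing, with the derivatives taken in the total space. -/
def smoothingHessian (g : Fin p → Cn n → ℂ) (x : Cn n × SmoothingParam n p) :
    Matrix (Fin n) (Fin n) ℂ :=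
  Matrix.of fun i j => fderiv ℂ (smoothingDifferential g) x (Pi.single i 1, 0) (Pi.single j 1)

theorem smoothingHessian_eq {g : Fin p → Cn n → ℂ} {z : Cn n} (hg : ∀ i, AnalyticAt ℂ (g i) z)
    (q : SmoothingParam n p) : smoothingHessian g (z, q) = Matrix.of fun i j : Fin n =>
      fderiv ℂ (pder (smoothing g q) j) z (Pi.single i 1) := by
  ext i j
  have h := (analyticAt_smoothingDifferential hg q).differentiableAt.hasFDerivAt.comp z
    (hasFDerivAt_prodMk_left (𝕜 := ℂ) z q)
  have h2 := (h.clm_apply (hasFDerivAt_const (Pi.single j 1 : Cn n) z)).fderiv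
  change _ = fderiv ℂ (fun z => fderiv ℂ (smoothing g q) z (Pi.single j 1)) z (Pi.single i 1)
  have h3 : (fun z => fderiv ℂ (smoothing g q) z (Pi.single j 1)) =
    fun z => (smoothingDifferential g ∘ fun z => (z, q)) z (Pi.single j 1) := rfl
  rw [h3, h2]
  simp [smoothingHessian]

theorem det_smoothingHessian_ne_zero {g : Fin p → Cn n → ℂ} {x : Cn n × SmoothingParam n p}
    (hs : Function.Surjective ((fderiv ℂ (smoothingDifferential g) x).comp
      (ContinuousLinearMap.inl ℂ (Cn n) (SmoothingParam n p)))) :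
    (smoothingHessian g x).det ≠ 0 := by
  rw [← isUnit_iff_ne_zero, ← Matrix.isUnit_iff_isUnit_det,
    ← Matrix.vecMul_surjective_iff_isUnit]
  intro y
  obtain ⟨v, hv⟩ := hs (covector y)
  refine ⟨v, funext fun j => ?_⟩
  have hy : covector y (Pi.single j 1) = y j := by simp [covector_apply, Pi.single_apply]
  rw [← hy, ← hv]
  let T : Cn n →L[ℂ] ℂ := ((ContinuousLinearMap.apply ℂ ℂ (Pi.single j 1 : Cn n)).comp
    ((fderiv ℂ (smoothingDifferential g) x).comp
      (ContinuousLinearMap.inl ℂ (Cn n) (SmoothingParam n p))))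
  have hT := covector_apply (fun k => T (Pi.single k 1)) v
  rw [covector_single] at hT
  change _ = T v
  rw [hT]
  change ∑ k, v k * T (Pi.single k 1) = _
  exact Finset.sum_congr rfl fun k _ => mul_comm _ _

theorem hasAdSingularityAt_smoothing {g : Fin p → Cn n → ℂ} {z : Cn n} {q : SmoothingParam n p}
    (hg : ∀ i, AnalyticAt ℂ (g i) z) {d : ℕ} (hd : d = n - p) (hz : ∀ i, g i z = q.1 i)
    (hb : ∀ i, ‖covector (q.2 i) z‖ < 1)
    (hs : Function.Surjective (ContinuousLinearMap.pi fun i => fderiv ℂ (g i) z)) :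
    HasAdSingularityAt n d p (smoothing g q) z := by
  let r : Fin p → Cn n → ℂ := fun i y => (1 + covector (q.2 i) y) ^ (((2 : ℕ) : ℂ)⁻¹)
  have hr2 : ∀ i y, r i y ^ 2 = 1 + covector (q.2 i) y := fun i y =>
    Complex.cpow_nat_inv_pow _ two_ne_zero
  have hslit : ∀ i, 1 + covector (q.2 i) z ∈ Complex.slitPlane := fun i =>
    Complex.mem_slitPlane_of_norm_lt_one (hb i)
  have hra : ∀ i, AnalyticAt ℂ (r i) z := fun i =>
    (analyticAt_const.add ((covector (q.2 i)).analyticAt z)).cpow analyticAt_const (hslit i)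
  have hr0 : ∀ i, r i z ≠ 0 := fun i h => by
    have := hr2 i z
    rw [h, zero_pow two_ne_zero] at this
    exact Complex.slitPlane_ne_zero (hslit i) this.symm
  let ω : Cn n → Fin p → ℂ := fun y i => r i y * (g i y - q.1 i)
  have hωa : AnalyticAt ℂ ω z := AnalyticAt.pi fun i => (hra i).mul ((hg i).sub analyticAt_const)
  have hωd : fderiv ℂ ω z = ContinuousLinearMap.pi fun i => r i z • fderiv ℂ (g i) z := by
    refine (hasFDerivAt_pi.2 fun i => ?_).fderiv
    refine ((hra i).differentiableAt.hasFDerivAt.mul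
      ((hg i).differentiableAt.hasFDerivAt.sub_const (q.1 i))).congr_fderiv ?_
    ext v
    simp [hz i]
  have hωs : Function.Surjective (fderiv ℂ ω z) := fun y => by
    obtain ⟨v, hv⟩ := hs fun i => y i / r i z
    refine ⟨v, funext fun i => ?_⟩
    have hvi : fderiv ℂ (g i) z v = y i / r i z := congrFun hv i
    rw [hωd]
    change r i z * fderiv ℂ (g i) z v = y i
    rw [hvi, mul_div_cancel₀ _ (hr0 i)]
  have hω0 : ω z = 0 := funext fun i => by simp [ω, hz i]
  have hFω : ∀ y, smoothing g q y = ∑ i, ω y i ^ 2 := fun y =>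
    Finset.sum_congr rfl fun i _ => by simp only [ω, mul_pow, hr2]
  have hF0 : smoothing g q z = 0 := by simp [hFω, hω0]
  obtain ⟨e, hze, he1, hea, hesymm⟩ := exists_straightening hωa hωs
  let K := (fderiv ℂ ω z).ker
  have hK : finrank ℂ K = finrank ℂ (Fin d → ℂ) := by
    have h1 : _ + finrank ℂ K = _ :=
      LinearMap.finrank_range_add_finrank_ker (fderiv ℂ ω z).toLinearMap
    rw [LinearMap.range_eq_top.2 hωs, finrank_top, finrank_fin_fun, finrank_fin_fun] at h1
    rw [finrank_fin_fun, hd]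
    omega
  let κ : K ≃L[ℂ] (Fin d → ℂ) := ContinuousLinearEquiv.ofFinrankEq hK
  let T : (Fin d → ℂ) × (Fin p → ℂ) → (Fin p → ℂ) × K := fun y => (y.2, (e z).2 + κ.symm y.1)
  let T' : (Fin p → ℂ) × K → (Fin d → ℂ) × (Fin p → ℂ) := fun y => (κ (y.2 - (e z).2), y.1)
  have hTa : ∀ y, AnalyticAt ℂ T y := fun y => analyticAt_snd.prod
    (analyticAt_const.add ((κ.symm : (Fin d → ℂ) →L[ℂ] K).analyticAt _ |>.comp analyticAt_fst))
  have hT'a : ∀ y, AnalyticAt ℂ T' y := fun y =>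
    AnalyticAt.prod ((κ : K →L[ℂ] (Fin d → ℂ)).analyticAt _ |>.comp
      (analyticAt_snd.sub analyticAt_const)) analyticAt_fst
  have hTT' : ∀ y, T (T' y) = y := fun y => by simp [T, T']
  have hT'T : ∀ y, T' (T y) = y := fun y => by simp [T, T']
  have hTc : Continuous T := continuous_iff_continuousAt.2 fun y => (hTa y).continuousAt
  have hez : e z = T 0 := Prod.ext (by rw [he1 z hze, hω0]; rfl) (by simp [T])
  refine ⟨T ⁻¹' e.target, e.source, e.symm ∘ T, T' ∘ e, e.open_target.preimage hTc,
    e.open_source, ?_, hze, ?_, fun y hy => (hesymm _ hy).comp (hTa y),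
    fun y hy => (hT'a _).comp (hea y hy), fun y hy => e.map_target hy, fun y hy => ?_,
    fun y hy => ?_, fun y hy => ?_, fun y hy => ?_⟩
  · rw [Set.mem_preimage, ← hez]; exact e.map_source hze
  · rw [Function.comp_apply, ← hez, e.left_inv hze]
  · rw [Set.mem_preimage, Function.comp_apply, hTT']; exact e.map_source hy
  · simp only [Function.comp_apply, e.right_inv hy, hT'T]
  · simp only [Function.comp_apply, hTT', e.left_inv hy]
  · have h1 : ω (e.symm (T y)) = y.2 := by
      rw [← he1 _ (e.map_target hy), e.right_inv hy]
    rw [hF0, sub_zero, Function.comp_apply, hFω, h1]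

/-- The conditions on the smoothing at the point `x.1`, for the parameter `x.2`: either `x.1` lies
on a smooth point of the fibre, or it is a nondegenerate critical point, or a regular point. -/
def SmoothingGood (g : Fin p → Cn n → ℂ) (x : Cn n × SmoothingParam n p) : Prop :=
  ((∀ i, g i x.1 = x.2.1 i) →
    Function.Surjective (ContinuousLinearMap.pi fun i => fderiv ℂ (g i) x.1)) ∧
  (smoothingDifferential g x = 0 → (∃ i, g i x.1 ≠ x.2.1 i) → (smoothingHessian g x).det ≠ 0)

theorem eventually_smoothingGood {g : Fin p → Cn n → ℂ} {z : Cn n} {q : SmoothingParam n p}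
    (hg : ∀ i, AnalyticAt ℂ (g i) z) (hb : ∀ i, 1 + covector (q.2 i) z ≠ 0)
    (h : SmoothingGood g (z, q)) : ∀ᶠ x in 𝓝 (z, q), SmoothingGood g x := by
  have hgc : ∀ i, ContinuousAt (fun x : Cn n × SmoothingParam n p => g i x.1 - x.2.1 i) (z, q) :=
    fun i => ((hg i).continuousAt.comp (x := (z, q)) (f := Prod.fst) continuousAt_fst).sub
      (by fun_prop)
  have hdc : ∀ i, ContinuousAt (fun x : Cn n × SmoothingParam n p => fderiv ℂ (g i) x.1) (z, q) :=
    fun i => (hg i).fderiv.continuousAt.comp (x := (z, q)) (f := Prod.fst) continuousAt_fst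
  by_cases hz : ∀ i, g i z = q.1 i
  · have hli := (surjective_pi_iff_linearIndependent _).1 (h.1 hz)
    have hcov : ContinuousAt (fun x : Cn n × SmoothingParam n p =>
        smoothingCovector g x.2 x.1) (z, q) := by
      refine continuousAt_pi.2 fun i => ?_
      have h1 : ContinuousAt (fun x : Cn n × SmoothingParam n p => covector (x.2.2 i)) (z, q) :=
        covector.continuous.continuousAt.comp (by fun_prop)
      exact (continuousAt_const.mul (continuousAt_const.add (h1.clm_apply continuousAt_fst))).smul
        (hdc i) |>.add ((hgc i).smul h1)
    have hcli : LinearIndependent ℂ (smoothingCovector g q z) := by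
      have hu := hli.units_smul fun i => Units.mk0 _ (mul_ne_zero two_ne_zero (hb i))
      convert hu using 1
      ext i v
      simp [smoothingCovector, hz i, Units.smul_def]
    filter_upwards [(continuousAt_pi.2 hdc).eventually hli.eventually,
      hcov.eventually hcli.eventually,
      continuousAt_fst.eventually (eventually_all.2 fun i => (hg i).eventually_analyticAt)]
      with x hx1 hx2 hx3
    refine ⟨fun _ => (surjective_pi_iff_linearIndependent _).2 hx1, fun hx0 hxi => ?_⟩
    rw [smoothingDifferential, fderiv_smoothing fun i => (hx3 i).differentiableAt] at hx0
    obtain ⟨i, hi⟩ := hxi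
    exact absurd (sub_eq_zero.1 (Fintype.linearIndependent_iff.1 hx2 _ hx0 i)) hi
  · push Not at hz
    obtain ⟨i, hi⟩ := hz
    have hne : ∀ᶠ x : Cn n × SmoothingParam n p in 𝓝 (z, q), g i x.1 - x.2.1 i ≠ 0 :=
      (hgc i).eventually_ne (sub_ne_zero.2 hi)
    have ha := analyticAt_smoothingDifferential hg q
    by_cases h0 : smoothingDifferential g (z, q) = 0
    · have hH : ContinuousAt (smoothingHessian g) (z, q) :=
        continuousAt_pi.2 fun i => continuousAt_pi.2 fun j =>
          (ha.fderiv.continuousAt.clm_apply continuousAt_const).clm_apply continuousAt_const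
      have hdet : ContinuousAt (fun x => (smoothingHessian g x).det) (z, q) :=
        (Continuous.matrix_det continuous_id).continuousAt.comp hH
      filter_upwards [hne, hdet.eventually_ne (h.2 h0 ⟨i, hi⟩)] with x hx1 hx2
      exact ⟨fun hx => absurd (sub_eq_zero.2 (hx i)) hx1, fun _ _ => hx2⟩
    · filter_upwards [hne, ha.continuousAt.eventually_ne h0] with x hx1 hx2
      exact ⟨fun hx => absurd (sub_eq_zero.2 (hx i)) hx1, fun hx => absurd hx hx2⟩

theorem measure_not_smoothingGood {g : Fin p → Cn n → ℂ} {W : Set (Cn n)}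
    (hg : ∀ i, ∀ z ∈ W, AnalyticAt ℂ (g i) z) (μ : Measure (SmoothingParam n p))
    [μ.IsAddHaarMeasure] :
    μ {q | ∃ z ∈ W, (∀ i, 1 - covector (q.2 i) z ≠ 0) ∧ ¬ SmoothingGood g (z, q)} = 0 := by
  let f : Cn n × (Fin p → Fin n → ℂ) → SmoothingParam n p := fun x => (fun i => g i x.1, x.2)
  let A : Set (Cn n × (Fin p → Fin n → ℂ)) := {x | x.1 ∈ W ∧
    ¬ Function.Surjective (ContinuousLinearMap.pi fun i => fderiv ℂ (g i) x.1)}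
  let B : Set (Cn n × SmoothingParam n p) := {x | x.1 ∈ W ∧
    (∀ i, 1 - covector (x.2.2 i) x.1 ≠ 0) ∧ smoothingDifferential g x = 0 ∧
    (∃ i, g i x.1 ≠ x.2.1 i) ∧ (smoothingHessian g x).det = 0}
  have hA : μ (f '' A) = 0 := by
    refine criticalValuesNull μ _ f A (fun x hx => ?_) fun x hx hs => hx.2 fun y => ?_
    · exact (AnalyticAt.pi fun i => AnalyticAt.comp (x := x) (f := Prod.fst) (hg i _ hx.1)
        analyticAt_fst).prod analyticAt_snd
    · have hf : HasFDerivAt f (((ContinuousLinearMap.pi fun i => fderiv ℂ (g i) x.1).comp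
          (ContinuousLinearMap.fst ℂ _ _)).prod (ContinuousLinearMap.snd ℂ _ _)) x :=
        (((hasFDerivAt_pi.2 fun i => (hg i _ hx.1).differentiableAt.hasFDerivAt).comp x
          hasFDerivAt_fst)).prodMk hasFDerivAt_snd
      rw [hf.fderiv] at hs
      obtain ⟨v, hv⟩ := hs (y, 0)
      exact ⟨v.1, congrArg Prod.fst hv⟩
  have hB : μ (Prod.snd '' B) = 0 := by
    refine measure_snd_image_null μ (Φ := smoothingDifferential g)
      (fun x hx => analyticAt_smoothingDifferential (fun i => hg i _ hx.1) x.2)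
      (fun x hx => hx.2.2.1) (fun x hx => ?_)
      fun x hx hs => det_smoothingHessian_ne_zero hs hx.2.2.2.2
    obtain ⟨i, hi⟩ := hx.2.2.2.1
    exact surjective_fderiv_smoothingDifferential (fun i => hg i _ hx.1) hi (hx.2.1 i)
  refine measure_mono_null ?_ (measure_union_null hA hB)
  rintro q ⟨z, hzW, hz, hbad⟩
  rw [SmoothingGood, not_and_or] at hbad
  rcases hbad with h | h
  · push Not at h
    exact Or.inl ⟨(z, q.2), ⟨hzW, h.2⟩, Prod.ext (funext h.1) rfl⟩
  · push Not at h
    exact Or.inr ⟨(z, q), ⟨hzW, hz, h⟩, rfl⟩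

theorem exists_dense_open_smoothingGood {g : Fin p → Cn n → ℂ} {W : Set (Cn n)}
    (hW : IsCompact W) (hg : ∀ i, ∀ z ∈ W, AnalyticAt ℂ (g i) z) :
    ∃ N ∈ 𝓝 (0 : SmoothingParam n p), ∃ U ⊆ N, IsOpen U ∧ N ⊆ closure U ∧
      ∀ q ∈ U, ∀ z ∈ W, (∀ i, ‖covector (q.2 i) z‖ < 1) ∧ SmoothingGood g (z, q) := by
  have hsmall : ∀ᶠ q : SmoothingParam n p in 𝓝 0, ∀ z ∈ W, ∀ i, ‖covector (q.2 i) z‖ < 1 := by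
    refine hW.eventually_forall_of_forall_eventually fun z _ => eventually_all.2 fun i => ?_
    have hc : Continuous fun x : SmoothingParam n p × Cn n => ‖covector (x.1.2 i) x.2‖ :=
      ((covector.continuous.comp (by fun_prop)).clm_apply continuous_snd).norm
    exact hc.continuousAt.eventually_lt continuousAt_const (by simp)
  obtain ⟨N, hN, hNo, h0N⟩ := eventually_nhds_iff.1 hsmall
  have hne : ∀ {c : ℂ}, ‖c‖ < 1 → 1 + c ≠ 0 ∧ 1 - c ≠ 0 := fun {c} hc =>
    ⟨fun h => by rw [eq_neg_of_add_eq_zero_right h] at hc; simp at hc,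
      fun h => by rw [← sub_eq_zero.1 h] at hc; simp at hc⟩
  let S : Set (SmoothingParam n p) := {q | ¬ ∃ z ∈ W, (∀ i, 1 - covector (q.2 i) z ≠ 0) ∧
    ¬ SmoothingGood g (z, q)}
  have hS : Dense S := Measure.dense_of_ae (μ := Measure.addHaar) (by
    rw [ae_iff]
    simpa only [not_not] using measure_not_smoothingGood hg Measure.addHaar)
  have hmem : ∀ q ∈ N ∩ S, ∀ z ∈ W, SmoothingGood g (z, q) := fun q hq z hz => by
    by_contra h
    exact hq.2 ⟨z, hz, fun i => (hne (hN q hq.1 z hz i)).2, h⟩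
  refine ⟨N, hNo.mem_nhds h0N, N ∩ S, Set.inter_subset_left, ?_,
    hS.open_subset_closure_inter hNo, fun q hq z hz => ⟨hN q hq.1 z hz, hmem q hq z hz⟩⟩
  refine isOpen_iff_mem_nhds.2 fun q hq => ?_
  filter_upwards [hNo.mem_nhds hq.1, hW.eventually_forall_of_forall_eventually
    (P := fun q z => SmoothingGood g (z, q)) fun z hz => (continuous_swap.tendsto (q, z)).eventually
      (eventually_smoothingGood (fun i => hg i z hz) (fun i => (hne (hN q hq.1 z hz i)).1)
        (hmem q hq z hz))] with q' hq' hgood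
  exact ⟨hq', fun ⟨z, hz, _, h⟩ => h (hgood z hz)⟩

end Smoothing

end RegularValues

/-- **Lemma 3.10.** Let `G = (g₁, …, g_p)` define a `d`-dimensional ICIS,
`d = n - p > 1`, and form the smoothing
`F(u,b,z) = Σᵢ (1 + Σⱼ bᵢⱼ zⱼ)(gᵢ(z) - uᵢ)²`.  Then for `(u,b)` in a dense
open subset of some neighborhood of `0` in `ℂ^p × ℂ^{pn}`: (i) `f_{u,b}` has
only `A₁` singularities off `G⁻¹(u)`, (ii) `G⁻¹(u)` is smooth, and
(iii) `f_{u,b}` has only `A(d)` singularities on `G⁻¹(u)`. -/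
theorem lemma_3_10 (n p : ℕ) (hp : 1 ≤ p) (hpn : p < n)
    (d : ℕ) (hd : d = n - p) (hd1 : 1 < d)
    (Ω : Set (Cn n)) (hΩ : IsOpen Ω) (h0Ω : (0 : Cn n) ∈ Ω)
    (g : Fin p → Cn n → ℂ) (hg : ∀ i, AnalyticOnNhd ℂ (g i) Ω)
    (hg0 : ∀ i, g i 0 = 0)
    (G : Cn n → (Fin p → ℂ)) (hG : G = fun z i => g i z)
    (hdim : ringKrullDim ((On n) ⧸ idealOfFuns (Set.range g)) = d)
    (hICIS : ∀ᶠ z in 𝓝 (0 : Cn n), G z = 0 → z ≠ 0 →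
      Function.Surjective (fderiv ℂ G z))
    (F : (Fin p → ℂ) × (Fin p → Fin n → ℂ) → Cn n → ℂ)
    (hF : F = fun ub z => ∑ i, (1 + ∑ j, ub.2 i j * z j) * (g i z - ub.1 i) ^ 2) :
    ∃ W : Set (Cn n), W ⊆ Ω ∧ W ∈ 𝓝 (0 : Cn n) ∧
      ∃ N ∈ 𝓝 (0 : (Fin p → ℂ) × (Fin p → Fin n → ℂ)),
        ∃ U : Set ((Fin p → ℂ) × (Fin p → Fin n → ℂ)),
          U ⊆ N ∧ IsOpen U ∧ N ⊆ closure U ∧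
          ∀ ub ∈ U,
            (∀ z ∈ W, fderiv ℂ (F ub) z = 0 → G z ≠ ub.1 →
              (Matrix.of fun i j : Fin n =>
                fderiv ℂ (pder (F ub) j) z (Pi.single i 1)).det ≠ 0) ∧
            (∀ z ∈ W, G z = ub.1 → Function.Surjective (fderiv ℂ G z)) ∧
            (∀ z ∈ W, G z = ub.1 → HasAdSingularityAt n d p (F ub) z) := by
  have hF' : ∀ q, F q = smoothing g q := fun q => by
    subst hF
    funext z
    simp [smoothing, covector_apply]
  have hGq : ∀ z (u : Fin p → ℂ), G z = u ↔ ∀ i, g i z = u i := fun z u => by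
    subst hG
    exact funext_iff
  have hGd : ∀ z ∈ Ω, fderiv ℂ G z = ContinuousLinearMap.pi fun i => fderiv ℂ (g i) z :=
    fun z hz => by
      subst hG
      exact (hasFDerivAt_pi.2 fun i => (hg i z hz).differentiableAt.hasFDerivAt).fderiv
  obtain ⟨r, hr, hrΩ⟩ := Metric.nhds_basis_closedBall.mem_iff.1 (hΩ.mem_nhds h0Ω)
  obtain ⟨N, hN, U, hUN, hU, hNU, hgood⟩ := exists_dense_open_smoothingGood (g := g)
    (isCompact_closedBall (0 : Cn n) r) fun i z hz => hg i z (hrΩ hz)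
  refine ⟨Metric.closedBall 0 r, hrΩ, Metric.closedBall_mem_nhds _ hr, N, hN, U, hUN, hU, hNU,
    fun q hq => ⟨fun z hz h0 hne => ?_, fun z hz hz0 => ?_, fun z hz hz0 => ?_⟩⟩
  · rw [hF'] at h0 ⊢
    rw [← smoothingHessian_eq (fun i => hg i z (hrΩ hz))]
    rw [Ne, hGq, not_forall] at hne
    exact (hgood q hq z hz).2.2 h0 hne
  · rw [hGd z (hrΩ hz)]
    exact (hgood q hq z hz).2.1 ((hGq _ _).1 hz0)
  · rw [hF']
    exact hasAdSingularityAt_smoothing (fun i => hg i z (hrΩ hz)) hd ((hGq _ _).1 hz0)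
      (hgood q hq z hz).1 ((hgood q hq z hz).2.1 ((hGq _ _).1 hz0))

end
end

section
/- Let R be a commutative local ring and let p ∈ R be an element that is not nilpotent. Let J be an ideal with J ⊆ pR which is a reduction of the principal ideal pR, i.e. (pR)^{N+1} = J·(pR)^N for some natural number N. Then J = pR. (This is the base case, d = 1, established in the proof of Lemma 4.3 of the paper.) -/
set_option maxHeartbeats 1000000

/-- The base case `d = 1` in the proof of **Lemma 4.3**: in a commutative
local ring `R`, if `p` is not nilpotent and `J ⊆ pR` is a reduction of the
principal ideal `pR` (i.e. `(pR)^(N+1) = J·(pR)^N` for some `N`),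
then `J = pR`. -/
theorem lemma_4_3_base (R : Type*) [CommRing R] [IsLocalRing R]
    (p : R) (hp : ¬ IsNilpotent p)
    (J : Ideal R) (hJ : J ≤ Ideal.span {p})
    (N : ℕ) (hred : (Ideal.span {p}) ^ (N + 1) = J * (Ideal.span {p}) ^ N) :
    J = Ideal.span {p} := by
  rw [Ideal.span_singleton_pow, Ideal.span_singleton_pow] at hred
  obtain ⟨j, hj, hjp⟩ := Ideal.mem_mul_span_singleton.mp
    (hred ▸ Ideal.mem_span_singleton_self (p ^ (N + 1)))
  obtain ⟨a, rfl⟩ := Ideal.mem_span_singleton.mp (hJ hj)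
  have h_zero : p ^ (N + 1) * (1 - a) = 0 := by linear_combination -hjp
  refine le_antisymm hJ ((Ideal.span_singleton_le_iff_mem J).mpr ?_)
  rcases IsLocalRing.isUnit_or_isUnit_one_sub_self a with ha | ha
  · exact (Ideal.mul_unit_mem_iff_mem J ha).mp hj
  · exact absurd ⟨N + 1, ha.mul_left_eq_zero.mp h_zero⟩ hp
end

section
/- Let p ≥ 1, n ≥ 1 and let H : U → Matrix (Fin p) (Fin p) ℂ be holomorphic on an open neighborhood U of 0 in ℂⁿ (each entry is analytic), with H(z) symmetric for every z ∈ U and H(0) invertible. Then there exist an open neighborhood V ⊆ U of 0 and a holomorphic map R : V → Matrix (Fin p) (Fin p) ℂ such that R(z) is invertible and R(z)ᵀ H(z) R(z) = 1 (the identity matrix) for every z ∈ V. (This is the congruence reduction established in the proof of Lemma 3.3 of the paper: an invertible symmetric matrix of analytic functions is congruent over the analytic functions to the identity.) -/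
open Filter Topology Matrix

set_option maxHeartbeats 1000000
set_option synthInstance.maxHeartbeats 400000

noncomputable section

/-- In a complex Banach algebra, squaring has an analytic local inverse near `1`. -/
theorem exists_analyticAt_sqrt_one (A : Type*) [NormedRing A] [NormedAlgebra ℂ A]
    [CompleteSpace A] :
    ∃ g : A → A, AnalyticAt ℂ g 1 ∧ g 1 = 1 ∧ (∀ᶠ y in 𝓝 (1 : A), g y * g y = y) ∧
      ∀ᶠ x in 𝓝 (1 : A), g (x * x) = x := by
  let f : A → A := fun x => x * x
  have hf : AnalyticAt ℂ f 1 := analyticAt_id.mul analyticAt_id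
  let e : A ≃L[ℂ] A := ContinuousLinearEquiv.smulLeft (Units.mk0 (2 : ℂ) two_ne_zero)
  have hfd : fderiv ℂ f 1 = (e : A →L[ℂ] A) := by
    have h := (hasFDerivAt_id (𝕜 := ℂ) (1 : A)).mul' (hasFDerivAt_id (𝕜 := ℂ) (1 : A))
    refine (h.congr_fderiv ?_).fderiv
    ext x
    simp [e, two_smul, Units.smul_def]
  have hs : HasStrictFDerivAt f (e : A →L[ℂ] A) 1 := hfd ▸ hf.hasStrictFDerivAt
  have h1 : f 1 = 1 := mul_one 1
  let P : OpenPartialHomeomorph A A := hs.toOpenPartialHomeomorph f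
  have hsymm : AnalyticAt ℂ P.symm (f 1) :=
    P.analyticAt_symm' hs.mem_toOpenPartialHomeomorph_source hf hfd
  refine ⟨hs.localInverse f e 1, ?_, ?_, ?_, hs.eventually_left_inverse⟩
  · rwa [h1] at hsymm
  · simpa only [h1] using hs.localInverse_apply_image
  · simpa only [h1] using hs.eventually_right_inverse

/-- An invertible complex symmetric matrix is congruent to the identity. -/
theorem Matrix.IsSymm.exists_transpose_mul_mul_eq_one {m : Type*} [Fintype m] [DecidableEq m]
    {S : Matrix m m ℂ} (hS : S.IsSymm) (hu : IsUnit S) :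
    ∃ C : Matrix m m ℂ, Cᵀ * S * C = 1 := by
  obtain ⟨v, hv⟩ := LinearMap.BilinForm.exists_orthogonal_basis (B := Matrix.toBilin' S)
    ⟨(Matrix.isSymm_toBilin'_iff_isSymm.mpr hS).eq⟩
  let e : Fin (Module.finrank ℂ (m → ℂ)) ≃ m :=
    Fintype.equivOfCardEq (by simp)
  let w := v.reindex e
  let P : Matrix m m ℂ := (Pi.basisFun ℂ m).toMatrix w
  have hP : IsUnit P := by
    have := (Pi.basisFun ℂ m).invertibleToMatrix w
    exact isUnit_of_invertible P
  have hentry : ∀ i j, (Pᵀ * S * P) i j = Matrix.toBilin' S (w i) (w j) := by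
    intro i j
    rw [Matrix.toBilin'_apply', Matrix.mul_assoc, Matrix.mul_apply_eq_vecMul]
    simp [P, dotProduct, Matrix.mul_apply, Matrix.mulVec, Module.Basis.toMatrix_apply,
      Matrix.vecMul]
  let d : m → ℂ := fun i => Matrix.toBilin' S (w i) (w i)
  have hdiag : Pᵀ * S * P = Matrix.diagonal d := by
    ext i j
    rw [hentry]
    by_cases hij : i = j
    · subst hij; simp [d]
    · rw [Matrix.diagonal_apply_ne _ hij]
      simpa [w] using hv (e.symm.injective.ne hij)
  have hd : ∀ i, d i ≠ 0 := by
    have : IsUnit (Matrix.diagonal d) :=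
      hdiag ▸ (((Matrix.isUnit_transpose P).mpr hP).mul hu).mul hP
    rw [Matrix.isUnit_diagonal, Pi.isUnit_iff] at this
    exact fun i => (this i).ne_zero
  choose s hs using fun i => IsAlgClosed.exists_eq_mul_self (d i)⁻¹
  refine ⟨P * Matrix.diagonal s, ?_⟩
  calc (P * Matrix.diagonal s)ᵀ * S * (P * Matrix.diagonal s)
      = Matrix.diagonal s * (Pᵀ * S * P) * Matrix.diagonal s := by
        simp only [Matrix.transpose_mul, Matrix.diagonal_transpose, Matrix.mul_assoc]
    _ = 1 := by
        rw [hdiag, Matrix.diagonal_mul_diagonal, Matrix.diagonal_mul_diagonal,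
          ← Matrix.diagonal_one]
        congr 1
        ext i
        rw [mul_right_comm, ← hs i, inv_mul_cancel₀ (hd i)]

section

open scoped Matrix.Norms.Operator

theorem Matrix.analyticAt_iff_entries {E : Type*} [NormedAddCommGroup E] [NormedSpace ℂ E]
    {m : Type*} [Fintype m] [DecidableEq m] {M : E → Matrix m m ℂ} {x : E} :
    AnalyticAt ℂ M x ↔ ∀ i j, AnalyticAt ℂ (fun z => M z i j) x := by
  constructor
  · intro h i j
    exact ((LinearMap.toContinuousLinearMap
      (Matrix.entryLinearMap ℂ ℂ i j)).analyticAt _).comp h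
  · intro h
    have hM : M = fun z => ∑ i, ∑ j, M z i j • Matrix.single i j (1 : ℂ) := by
      ext1 z
      conv_lhs => rw [Matrix.matrix_eq_sum_single (M z)]
      simp [Matrix.smul_single]
    rw [hM]
    refine Finset.analyticAt_fun_sum _ fun i _ => Finset.analyticAt_fun_sum _ fun j _ => ?_
    exact (h i j).smul analyticAt_const

/-- A germ of a holomorphic family of symmetric matrices, invertible at the base point, is
congruent to its constant value at that point. -/
theorem Matrix.exists_analyticAt_transpose_mul_mul_eq {E : Type*} [NormedAddCommGroup E]
    [NormedSpace ℂ E] {m : Type*} [Fintype m] [DecidableEq m] {H : E → Matrix m m ℂ} {x : E}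
    (hH : AnalyticAt ℂ H x) (hsymm : ∀ᶠ z in 𝓝 x, (H z)ᵀ = H z) (hinv : IsUnit (H x)) :
    ∃ G : E → Matrix m m ℂ, AnalyticAt ℂ G x ∧ ∀ᶠ z in 𝓝 x, (G z)ᵀ * H z * G z = H x := by
  obtain ⟨g, hg, hg1, hgr, hgl⟩ := exists_analyticAt_sqrt_one (Matrix m m ℂ)
  obtain ⟨u, hu⟩ := hinv
  have hI : AnalyticAt ℂ (fun z => Ring.inverse (H z)) x := by
    refine AnalyticAt.comp (g := Ring.inverse) ?_ hH
    rw [← hu]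
    exact analyticAt_inverse u
  let W : E → Matrix m m ℂ := fun z => Ring.inverse (H z) * H x
  have hW : AnalyticAt ℂ W x := hI.mul analyticAt_const
  have hWx : W x = 1 := Ring.inverse_mul_cancel _ ⟨u, hu⟩
  let G : E → Matrix m m ℂ := fun z => g (W z)
  have hG : AnalyticAt ℂ G x := AnalyticAt.comp (by rwa [hWx]) hW
  have hGx : G x = 1 := by simp only [G, hWx, hg1]
  let τ : Matrix m m ℂ → Matrix m m ℂ := fun X => (↑u⁻¹ : Matrix m m ℂ) * Xᵀ * u
  have hτ : Continuous τ := by fun_prop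
  have hτ1 : τ 1 = 1 := by simp [τ]
  have hWt : Tendsto W (𝓝 x) (𝓝 1) := hWx ▸ hW.continuousAt.tendsto
  have hτGt : Tendsto (fun z => τ (G z)) (𝓝 x) (𝓝 1) := by
    have := hτ.continuousAt.tendsto.comp hG.continuousAt.tendsto
    rwa [hGx, hτ1] at this
  have hunit : ∀ᶠ z in 𝓝 x, IsUnit (H z) :=
    hH.continuousAt.eventually (hu ▸ Units.nhds u)
  refine ⟨G, hG, ?_⟩
  have hsx := hsymm.self_of_nhds
  filter_upwards [hsymm, hunit, hWt.eventually hgr, hτGt.eventually hgl] with z hz hzu hsq hinj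
  have hHW : H z * W z = H x := by
    simp only [W]
    rw [← mul_assoc, Ring.mul_inverse_cancel _ hzu, one_mul]
  have hGG : G z * G z = W z := hsq
  have hτW : τ (W z) = W z := by
    simp only [τ, W, Matrix.transpose_mul, hsx]
    rw [← Matrix.nonsing_inv_eq_ringInverse, Matrix.transpose_nonsing_inv, hz, ← hu,
      ← mul_assoc, Units.inv_mul, one_mul]
  have hτmul : τ (G z) * τ (G z) = τ (G z * G z) := by
    simp only [τ, Matrix.transpose_mul, mul_assoc, Units.mul_inv_cancel_left]
  have hτG : τ (G z) = G z := by
    rw [← hinj, hτmul, hGG, hτW]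
  have hcomm : (G z)ᵀ * H x = H x * G z := by
    conv_rhs => rw [← hτG]
    simp only [τ, ← hu, mul_assoc, Units.mul_inv_cancel_left]
  have hGu : IsUnit (G z) := by
    have h : ((↑u⁻¹ : Matrix m m ℂ) * (H z * G z)) * G z = 1 := by
      rw [mul_assoc, mul_assoc, hGG, hHW, ← hu, Units.inv_mul]
    exact IsUnit.of_mul_eq_one_right _ h
  apply hGu.mul_right_cancel
  rw [mul_assoc, hGG, mul_assoc, hHW, hcomm]

end

/-- The congruence reduction in the proof of **Lemma 3.3**: if `H` is a
holomorphic symmetric-matrix-valued map near `0 ∈ ℂⁿ` with `H 0` invertible,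
then on some neighborhood `V` of `0` there is a holomorphic map `R` with
`R z` invertible and `(R z)ᵀ * H z * R z = 1` for all `z ∈ V`. -/
theorem congruence_reduction (p n : ℕ) (hp : 1 ≤ p) (hn : 1 ≤ n)
    (U : Set (Cn n)) (hU : IsOpen U) (h0U : (0 : Cn n) ∈ U)
    (H : Cn n → Matrix (Fin p) (Fin p) ℂ)
    (hH : ∀ i j, AnalyticOnNhd ℂ (fun z => H z i j) U)
    (hsymm : ∀ z ∈ U, (H z)ᵀ = H z)
    (hinv : IsUnit (H 0)) :
    ∃ V : Set (Cn n), V ⊆ U ∧ IsOpen V ∧ (0 : Cn n) ∈ V ∧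
      ∃ R : Cn n → Matrix (Fin p) (Fin p) ℂ,
        (∀ i j, AnalyticOnNhd ℂ (fun z => R z i j) V) ∧
        ∀ z ∈ V, IsUnit (R z) ∧ (R z)ᵀ * H z * R z = 1 := by
  have hU0 : U ∈ 𝓝 (0 : Cn n) := hU.mem_nhds h0U
  have hs : ∀ᶠ z in 𝓝 (0 : Cn n), (H z)ᵀ = H z := eventually_of_mem hU0 hsymm
  obtain ⟨G, hG, hGH⟩ := Matrix.exists_analyticAt_transpose_mul_mul_eq
    (Matrix.analyticAt_iff_entries.mpr fun i j => hH i j 0 h0U) hs hinv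
  obtain ⟨C, hC⟩ := Matrix.IsSymm.exists_transpose_mul_mul_eq_one (hsymm 0 h0U) hinv
  have hGC : ∀ i j, AnalyticAt ℂ (fun z => (G z * C) i j) 0 := by
    simp only [Matrix.mul_apply]
    exact fun i j => Finset.analyticAt_fun_sum _ fun k _ =>
      (Matrix.analyticAt_iff_entries.mp hG i k).mul analyticAt_const
  have han : ∀ᶠ z in 𝓝 (0 : Cn n), ∀ i j, AnalyticAt ℂ (fun z => (G z * C) i j) z :=
    eventually_all.mpr fun i => eventually_all.mpr fun j => (hGC i j).eventually_analyticAt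
  obtain ⟨V, hV, hVo, h0V⟩ := eventually_nhds_iff.mp (hU.eventually_mem h0U |>.and (hGH.and han))
  refine ⟨V, fun z hz => (hV z hz).1, hVo, h0V, fun z => G z * C,
    fun i j z hz => (hV z hz).2.2 i j, fun z hz => ?_⟩
  have h : (G z * C)ᵀ * H z * (G z * C) = 1 := by
    rw [← hC, ← (hV z hz).2.1]
    simp only [Matrix.transpose_mul, Matrix.mul_assoc]
  exact ⟨IsUnit.of_mul_eq_one_right _ h, h⟩
end
end

section
/- Let p > 1 and let g₁,…,g_p be holomorphic on an open set Ω ⊆ ℂⁿ containing 0, with g_i(0) = 0, G = (g₁,…,g_p). For a ∈ ℂ^p let h_a(x) = Σ_{i=1}^p a_i x_i² and f_a = h_a ∘ G = Σ_{i=1}^p a_i g_i². Then there is a subset U ⊆ ℂ^p whose complement is Lebesgue-null (in particular U is dense) such that for every a ∈ U and every z ∈ Ω with G(z) ≠ 0 and f_a(z) = 0, the differential d f_a(z) is nonzero; i.e. off G^{-1}(0) the zero fiber of h_a ∘ G is smooth and h_a ∘ G is a submersion along it. (This is the transversality content of Proposition 3.9 of the paper, established via the parametric Sard argument in its proof.)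 -/
open Filter Topology

set_option maxHeartbeats 1000000
set_option synthInstance.maxHeartbeats 400000

noncomputable section

/-- If the image of `S` under `F` is countable locally near each point of `S`, it is countable. -/
theorem countable_image_of_locally {X Y : Type*} [TopologicalSpace X] [SecondCountableTopology X]
    {F : X → Y} {S : Set X} (h : ∀ x ∈ S, ∃ V ∈ 𝓝 x, (F '' (S ∩ V)).Countable) :
    (F '' S).Countable := by
  choose! V hV hc using h
  obtain ⟨t, htS, htc, hcov⟩ := TopologicalSpace.countable_cover_nhdsWithin
    (f := V) (s := S) fun x hx => mem_nhdsWithin_of_mem_nhds (hV x hx)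
  refine (htc.biUnion fun x hx => hc x (htS hx)).mono ?_
  rintro _ ⟨y, hy, rfl⟩
  obtain ⟨x, hx, hyx⟩ := Set.mem_iUnion₂.1 (hcov hy)
  exact Set.mem_iUnion₂.2 ⟨x, hx, y, ⟨hy, hyx⟩, rfl⟩

/-- The critical points of `F` at which `F` is analytic. -/
def analyticCriticalSet {E : Type*} [NormedAddCommGroup E] [NormedSpace ℂ E] (F : E → ℂ) :
    Set E :=
  {x | AnalyticAt ℂ F x ∧ fderiv ℂ F x = 0}

section Sard

variable {E : Type*} [NormedAddCommGroup E] [NormedSpace ℂ E]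

/-- An analytic function all of whose derivatives vanish at `x` is constant near `x`. -/
theorem eventually_eq_of_iteratedFDeriv_eq_zero {F : E → ℂ} {x : E} (hF : AnalyticAt ℂ F x)
    (h : ∀ k, iteratedFDeriv ℂ (k + 1) F x = 0) : ∀ᶠ y in 𝓝 x, F y = F x := by
  obtain ⟨P, r, hP⟩ := hF
  filter_upwards [Metric.eball_mem_nhds x hP.r_pos] with y hy
  have hy' : y - x ∈ Metric.eball (0 : E) r := by
    simpa [edist_eq_enorm_sub] using hy
  have h1 := hP.hasSum_iteratedFDeriv hy'
  rw [add_sub_cancel] at h1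
  have h2 := h1.unique (hasSum_single 0 ?_)
  · simpa using h2
  · rintro (_ | k) hk
    · exact absurd rfl hk
    · simp [h k]

variable [FiniteDimensional ℂ E]

/-- A function `w` with nonzero differential at `x` is straightened by a local analytic
diffeomorphism: near `x`, its zero set is carried to the kernel of the differential. -/
theorem exists_straightening_s10 {w : E → ℂ} {x : E} (hw : AnalyticAt ℂ w x)
    (hw' : fderiv ℂ w x ≠ 0) :
    ∃ e : OpenPartialHomeomorph E E, x ∈ e.source ∧ AnalyticAt ℂ e.symm (e x) ∧
      ∀ y, fderiv ℂ w x (e y) = w y := by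
  have : CompleteSpace E := FiniteDimensional.complete ℂ E
  set L := fderiv ℂ w x with hL
  obtain ⟨v, hv⟩ : ∃ v, L v = 1 := by
    obtain ⟨u, hu⟩ : ∃ u, L u ≠ 0 := by
      by_contra! hcon
      exact hw' (ContinuousLinearMap.ext hcon)
    exact ⟨(L u)⁻¹ • u, by simp [hu]⟩
  let Φ : E → E := fun y => y + (w y - L y) • v
  have hΦ : AnalyticAt ℂ Φ x :=
    analyticAt_id.add ((hw.sub (L.analyticAt x)).smul analyticAt_const)
  have hd : HasStrictFDerivAt Φ ((ContinuousLinearEquiv.refl ℂ E : E ≃L[ℂ] E) : E →L[ℂ] E) x := by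
    have h1 := (hasStrictFDerivAt_id (𝕜 := ℂ) x).add
      ((hw.hasStrictFDerivAt.sub L.hasStrictFDerivAt).smul_const v)
    refine h1.congr_fderiv ?_
    ext y
    simp [← hL]
  refine ⟨hd.toOpenPartialHomeomorph Φ, hd.mem_toOpenPartialHomeomorph_source, ?_, fun y => ?_⟩
  · refine OpenPartialHomeomorph.analyticAt_symm' (i := ContinuousLinearEquiv.refl ℂ E) _
      hd.mem_toOpenPartialHomeomorph_source ?_ ?_
    · simpa using hΦ
    · simpa using hd.hasFDerivAt.fderiv
  · simp [Φ, hv]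

/-- Critical values on a smooth hypersurface `w = 0` are locally critical values of a function
on the tangent space of that hypersurface. -/
theorem locally_countable_image_of_hypersurface {F w : E → ℂ} {x : E}
    (hw : AnalyticAt ℂ w x) (hw' : fderiv ℂ w x ≠ 0)
    (ih : ∀ H : (fderiv ℂ w x).ker → ℂ, (H '' analyticCriticalSet H).Countable) :
    ∃ V ∈ 𝓝 x, (F '' ((analyticCriticalSet F ∩ {y | w y = 0}) ∩ V)).Countable := by
  have : CompleteSpace E := FiniteDimensional.complete ℂ E
  obtain ⟨e, hxe, hsymm, he⟩ := exists_straightening_s10 hw hw'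
  set L := fderiv ℂ w x
  have hev : ∀ᶠ y in 𝓝 x, y ∈ e.source ∧ AnalyticAt ℂ e.symm (e y) :=
    (e.open_source.eventually_mem hxe).and
      ((e.continuousAt hxe).eventually hsymm.eventually_analyticAt)
  refine ⟨_, hev, (ih fun u => F (e.symm u)).mono ?_⟩
  rintro _ ⟨y, ⟨⟨⟨hFy, hdF⟩, hwy⟩, hys, hya⟩, rfl⟩
  have hmem : e y ∈ L.ker := by
    simpa [LinearMap.mem_ker, he] using hwy
  have hinv : e.symm (e y) = y := e.left_inv hys
  let u : L.ker := ⟨e y, hmem⟩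
  have hσ : AnalyticAt ℂ (fun u : L.ker => e.symm (u : E)) u :=
    AnalyticAt.comp (g := e.symm) (f := fun u : L.ker => (u : E)) hya
      (L.ker.subtypeL.analyticAt u)
  refine ⟨u, ⟨?_, ?_⟩, by simp [u, hinv]⟩
  · exact AnalyticAt.comp (g := F) (f := fun u : L.ker => e.symm (u : E))
      (by simpa [u, hinv] using hFy) hσ
  · have h1 : HasFDerivAt F (0 : E →L[ℂ] ℂ) (e.symm (u : E)) := by
      have h2 := hFy.differentiableAt.hasFDerivAt
      rw [hdF] at h2
      simpa [u, hinv] using h2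
    have h3 := h1.comp u hσ.differentiableAt.hasFDerivAt
    simpa [Function.comp_def] using h3.fderiv

end Sard

/-- **Sard's theorem** for a scalar analytic function of several complex variables: the set of
critical values is countable. -/
theorem countable_critical_values (d : ℕ) :
    ∀ (E : Type) [NormedAddCommGroup E] [NormedSpace ℂ E] [FiniteDimensional ℂ E],
      Module.finrank ℂ E = d → ∀ F : E → ℂ, (F '' analyticCriticalSet F).Countable := by
  induction d with
  | zero =>
    intro E _ _ _ hd F
    have : Subsingleton E := Module.finrank_zero_iff.1 hd
    exact (Set.subsingleton_of_subsingleton.image F).countable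
  | succ d ih =>
    intro E _ _ _ hd F
    have : CompleteSpace E := FiniteDimensional.complete ℂ E
    have : ProperSpace E := FiniteDimensional.proper ℂ E
    let D : ℕ → Set E := fun k => {x | x ∈ analyticCriticalSet F ∧
      iteratedFDeriv ℂ k F x = 0 ∧ iteratedFDeriv ℂ (k + 1) F x ≠ 0}
    let D' : Set E := {x | x ∈ analyticCriticalSet F ∧ ∀ k, iteratedFDeriv ℂ (k + 1) F x = 0}
    have hcover : analyticCriticalSet F ⊆ D' ∪ ⋃ k, D k := by
      intro x hx
      by_cases hall : ∀ k, iteratedFDeriv ℂ (k + 1) F x = 0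
      · exact Or.inl ⟨hx, hall⟩
      · push Not at hall
        classical
        refine Or.inr (Set.mem_iUnion.2 ⟨Nat.find hall, hx, ?_, Nat.find_spec hall⟩)
        rcases hk : Nat.find hall with _ | k
        · exfalso
          have h1 := Nat.find_spec hall
          rw [hk] at h1
          apply h1
          ext m
          simp [iteratedFDeriv_succ_apply_right, hx.2]
        · have := Nat.find_min hall (m := k) (by omega)
          simpa using this
    refine Set.Countable.mono (Set.image_mono hcover) ?_
    rw [Set.image_union, Set.image_iUnion]
    refine Set.Countable.union ?_ (Set.countable_iUnion fun k => ?_)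
    · refine countable_image_of_locally fun x hx =>
        ⟨_, eventually_eq_of_iteratedFDeriv_eq_zero hx.1.1 hx.2, ?_⟩
      refine (Set.countable_singleton (F x)).mono ?_
      rintro _ ⟨y, ⟨-, hy⟩, rfl⟩
      exact hy
    · refine countable_image_of_locally fun x hx => ?_
      obtain ⟨hxc, -, hk1⟩ := hx
      obtain ⟨m, hm⟩ : ∃ m, iteratedFDeriv ℂ (k + 1) F x m ≠ 0 := by
        by_contra! hcon
        exact hk1 (ContinuousMultilinearMap.ext hcon)
      let ev := ContinuousMultilinearMap.apply ℂ (fun _ : Fin k => E) ℂ (Fin.tail m)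
      let w : E → ℂ := fun y => ev (iteratedFDeriv ℂ k F y)
      have hit : AnalyticAt ℂ (iteratedFDeriv ℂ k F) x :=
        AnalyticOnNhd.iteratedFDeriv (s := {x}) (by simpa [AnalyticOnNhd] using hxc.1) k x rfl
      have hw : AnalyticAt ℂ w x := (ev.analyticAt _).comp hit
      have hw' : fderiv ℂ w x ≠ 0 := by
        intro h0
        apply hm
        have h1 := ev.hasFDerivAt.comp x hit.differentiableAt.hasFDerivAt
        have h2 : fderiv ℂ w x = _ := h1.fderiv
        rw [h0] at h2
        have h3 := congrArg (fun T : E →L[ℂ] ℂ => T (m 0)) h2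
        rw [iteratedFDeriv_succ_apply_left]
        simpa [ev] using h3.symm
      have hrank : Module.finrank ℂ (fderiv ℂ w x).ker = d := by
        have h1 := Module.Dual.finrank_ker_add_one_of_ne_zero
          (f := (fderiv ℂ w x : E →ₗ[ℂ] ℂ)) (fun h => hw' (by
            ext y
            exact LinearMap.congr_fun h y))
        rw [hd] at h1
        exact Nat.succ_injective h1
      obtain ⟨V, hV, hc⟩ := locally_countable_image_of_hypersurface hw hw' (ih _ hrank)
      refine ⟨V, hV, hc.mono (Set.image_mono ?_)⟩
      rintro y ⟨⟨hyc, hy0, -⟩, hyV⟩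
      exact ⟨⟨hyc, by simp [w, hy0]⟩, hyV⟩

section Diagonal

variable {n p : ℕ} {Ω : Set (Cn n)} {g : Fin p → Cn n → ℂ}

/-- The differential of `Σᵢ aᵢ gᵢ²`. -/
theorem hasFDerivAt_sum_mul_sq {z : Cn n} (hg : ∀ i, AnalyticAt ℂ (g i) z) (a : Fin p → ℂ) :
    HasFDerivAt (fun w => ∑ i, a i * (g i w) ^ 2)
      (∑ i, (a i * (2 * g i z)) • fderiv ℂ (g i) z) z := by
  refine HasFDerivAt.fun_sum fun i _ => ?_
  refine (((hg i).differentiableAt.hasFDerivAt.pow 2).const_mul (a i)).congr_fderiv ?_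
  ext v
  simp
  ring

/-- The parameters `a` for which `Σⱼ aⱼ gⱼ²` has a singular zero in `Ω` where `gᵢ ≠ 0`. -/
def singularParameters (Ω : Set (Cn n)) (g : Fin p → Cn n → ℂ) (i : Fin p) :
    Set (Fin p → ℂ) :=
  {a | ∃ z ∈ Ω, g i z ≠ 0 ∧ (∑ j, a j * (g j z) ^ 2) = 0 ∧
    fderiv ℂ (fun w => ∑ j, a j * (g j w) ^ 2) z = 0}

theorem measurableSet_singularParameters (hΩ : IsOpen Ω) (hg : ∀ i, AnalyticOnNhd ℂ (g i) Ω)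
    (i : Fin p) : MeasurableSet (singularParameters Ω g i) := by
  let W : Set (Cn n) := Ω ∩ g i ⁻¹' {0}ᶜ
  have hW : IsOpen W := (hg i).continuousOn.isOpen_inter_preimage hΩ isOpen_compl_singleton
  have : LocallyCompactSpace W := hW.locallyCompactSpace
  have hgc (j : Fin p) : Continuous fun z : W => g j z :=
    ((hg j).continuousOn.mono Set.inter_subset_left).domRestrict
  have hdc (j : Fin p) : Continuous fun z : W => fderiv ℂ (g j) z :=
    ((hg j).fderiv.continuousOn.mono Set.inter_subset_left).domRestrict
  have hgc' (j : Fin p) : Continuous fun q : (Fin p → ℂ) × W => g j q.2 :=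
    (hgc j).comp continuous_snd
  have hac (j : Fin p) : Continuous fun q : (Fin p → ℂ) × W => q.1 j :=
    (continuous_apply j).comp continuous_fst
  let T : Set ((Fin p → ℂ) × W) := {q | (∑ j, q.1 j * (g j q.2) ^ 2) = 0} ∩
    {q | (∑ j, (q.1 j * (2 * g j q.2)) • fderiv ℂ (g j) q.2) = 0}
  have hT : IsClosed T := by
    refine (isClosed_eq ?_ continuous_const).inter (isClosed_eq ?_ continuous_const)
    · exact continuous_finsetSum _ fun j _ => (hac j).mul ((hgc' j).pow 2)
    · exact continuous_finsetSum _ fun j _ =>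
        ((hac j).mul (continuous_const.mul (hgc' j))).smul ((hdc j).comp continuous_snd)
  have himg : singularParameters Ω g i = Prod.fst '' T := by
    ext a
    constructor
    · rintro ⟨z, hz, hgz, h1, h2⟩
      rw [(hasFDerivAt_sum_mul_sq (fun j => hg j z hz) a).fderiv] at h2
      exact ⟨(a, ⟨z, hz, hgz⟩), ⟨h1, h2⟩, rfl⟩
    · rintro ⟨⟨a, z, hz, hgz⟩, ⟨h1, h2⟩, rfl⟩
      refine ⟨z, hz, hgz, h1, ?_⟩
      rw [(hasFDerivAt_sum_mul_sq (fun j => hg j z hz) a).fderiv]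
      exact h2
  have hσ : IsSigmaCompact (Prod.fst '' T) :=
    (isSigmaCompact_univ.of_isClosed_subset hT (Set.subset_univ _)).image continuous_fst
  obtain ⟨K, hK, hKu⟩ := hσ
  rw [himg, ← hKu]
  exact MeasurableSet.iUnion fun k => (hK k).isClosed.measurableSet

/-- Along lines in the `i`-th coordinate direction, the singular parameters are critical values
of an analytic function, so there are countably many of them. -/
theorem countable_singularParameters_line (hg : ∀ i, AnalyticOnNhd ℂ (g i) Ω) (i : Fin p)
    (y : Fin p → ℂ) :
    {t : ℂ | y + Pi.single i t ∈ singularParameters Ω g i}.Countable := by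
  let F : Cn n → ℂ := fun z => -((∑ j, y j * (g j z) ^ 2) * ((g i z) ^ 2)⁻¹)
  refine (countable_critical_values _ (Cn n) rfl F).mono ?_
  rintro t ⟨z, hz, hgz, h1, h2⟩
  have hga (j : Fin p) : AnalyticAt ℂ (g j) z := hg j z hz
  have hexp (w : Cn n) : ∑ j, (y + Pi.single i t : Fin p → ℂ) j * (g j w) ^ 2 =
      (∑ j, y j * (g j w) ^ 2) + t * (g i w) ^ 2 := by
    simp [add_mul, Finset.sum_add_distrib, Pi.single_apply]
  have hz2 : (g i z) ^ 2 ≠ 0 := pow_ne_zero 2 hgz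
  have hinv : AnalyticAt ℂ (fun w => ((g i w) ^ 2)⁻¹) z := ((hga i).pow 2).inv hz2
  have hsum : AnalyticAt ℂ (fun w => ∑ j, y j * (g j w) ^ 2) z :=
    Finset.analyticAt_fun_sum _ fun j _ => analyticAt_const.mul ((hga j).pow 2)
  refine ⟨z, ⟨(hsum.mul hinv).neg, ?_⟩, ?_⟩
  · have hev : F =ᶠ[𝓝 z] fun w =>
        t - (∑ j, (y + Pi.single i t : Fin p → ℂ) j * (g j w) ^ 2) * ((g i w) ^ 2)⁻¹ := by
      filter_upwards [(hga i).continuousAt.eventually_ne hgz] with w hw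
      rw [hexp]
      simp only [F]
      field_simp
      ring
    rw [hev.fderiv_eq]
    have hf := (hasFDerivAt_sum_mul_sq hga (y + Pi.single i t)).differentiableAt.hasFDerivAt
    rw [h2] at hf
    have h3 := (hf.mul hinv.differentiableAt.hasFDerivAt).const_sub t
    rw [h1] at h3
    refine h3.fderiv.trans (ContinuousLinearMap.ext fun v => ?_)
    simp
  · rw [hexp] at h1
    simp only [F]
    field_simp
    linear_combination -h1

theorem volume_singularParameters (hΩ : IsOpen Ω) (hg : ∀ i, AnalyticOnNhd ℂ (g i) Ω)
    (i : Fin p) : MeasureTheory.volume (singularParameters Ω g i) = 0 := by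
  have h := (MeasureTheory.ae_ae_add_linearMap_mem_iff (LinearMap.single ℂ (fun _ : Fin p => ℂ) i)
    MeasureTheory.volume MeasureTheory.volume
    (measurableSet_singularParameters hΩ hg i).compl).1 (Eventually.of_forall fun y => ?_)
  · simpa [MeasureTheory.ae_iff] using h
  · rw [MeasureTheory.ae_iff]
    simpa using (countable_singularParameters_line hg i y).measure_zero MeasureTheory.volume

end Diagonal

/-- **Proposition 3.9** (transversality content).  For `h_a(x) = Σᵢ aᵢ xᵢ²`
and `f_a = h_a ∘ G = Σᵢ aᵢ gᵢ²`, for `a` outside a Lebesgue-null set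
(in particular, for `a` in a dense set), the zero fiber of `f_a` off
`G⁻¹(0)` is smooth: `d f_a (z) ≠ 0` whenever `G z ≠ 0` and `f_a z = 0`. -/
theorem proposition_3_9 (n p : ℕ) (hp : 1 < p)
    (Ω : Set (Cn n)) (hΩ : IsOpen Ω) (h0Ω : (0 : Cn n) ∈ Ω)
    (g : Fin p → Cn n → ℂ) (hg : ∀ i, AnalyticOnNhd ℂ (g i) Ω)
    (hg0 : ∀ i, g i 0 = 0) :
    ∃ U : Set (Fin p → ℂ), MeasureTheory.volume Uᶜ = 0 ∧ Dense U ∧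
      ∀ a ∈ U, ∀ z ∈ Ω, (∃ i, g i z ≠ 0) →
        (∑ i, a i * (g i z) ^ 2) = 0 →
        fderiv ℂ (fun w => ∑ i, a i * (g i w) ^ 2) z ≠ 0 := by
  have hnull : MeasureTheory.volume (⋃ i, singularParameters Ω g i) = 0 :=
    MeasureTheory.measure_iUnion_null fun i => volume_singularParameters hΩ hg i
  refine ⟨(⋃ i, singularParameters Ω g i)ᶜ, by rwa [compl_compl], ?_, ?_⟩
  · exact MeasureTheory.Measure.dense_of_ae (μ := MeasureTheory.volume)
      (p := fun a => a ∉ ⋃ i, singularParameters Ω g i)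
      (MeasureTheory.measure_eq_zero_iff_ae_notMem.1 hnull)
  · rintro a ha z hz ⟨i, hi⟩ h0 hd
    exact ha (Set.mem_iUnion.2 ⟨i, z, hz, hi, h0, hd⟩)

end
end

section
/- Let p ≥ 1 and let h be holomorphic near 0 in ℂ^p with h(0) = 0, dh(0) = 0 and nondegenerate Hessian at 0 (h has a Morse singularity at the origin). Let g₁,…,g_p be holomorphic near 0 in ℂⁿ with g_i(0) = 0 and G = (g₁,…,g_p). Then in the ring O_n of analytic germs at 0, the ideal generated by the germs of (∂h/∂w₁) ∘ G, …, (∂h/∂w_p) ∘ G equals the ideal I generated by the germs of g₁,…,g_p; that is, G*(J(h))O_n = I. (This is the assertion underlying Corollary 3.7 of the paper.) -/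
open Filter Topology

set_option maxHeartbeats 1000000
set_option synthInstance.maxHeartbeats 400000

noncomputable section

/-- A one-term Taylor expansion with analytic coefficients: near `0`, an analytic map differs from
its value at `0` by an analytic family of linear maps applied to the argument. -/
theorem AnalyticAt.exists_eventually_eq_add_clm_apply {E F : Type*}
    [NormedAddCommGroup E] [NormedSpace ℂ E] [NormedAddCommGroup F] [NormedSpace ℂ F]
    [CompleteSpace F] {f : E → F} (hf : AnalyticAt ℂ f 0) :
    ∃ A : E → E →L[ℂ] F, AnalyticAt ℂ A 0 ∧ A 0 = fderiv ℂ f 0 ∧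
      ∀ᶠ w in 𝓝 0, f w = f 0 + A w w := by
  obtain ⟨P, r, hP⟩ := hf
  have hrad : 0 < P.shift.radius := by
    rw [P.radius_shift]
    exact hP.r_pos.trans_le hP.r_le
  have hA := P.shift.hasFPowerSeriesOnBall hrad
  have heq : P.shift.unshift (f 0) = P := by
    ext n v
    cases n with
    | zero => simp [FormalMultilinearSeries.unshift, hP.coeff_zero]
    | succ n => simp [FormalMultilinearSeries.unshift, FormalMultilinearSeries.shift]
  have hU := hA.unshift (z := f 0)
  rw [heq] at hU
  refine ⟨P.shift.sum, hA.analyticAt, ?_, ?_⟩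
  · rw [hP.hasFPowerSeriesAt.fderiv_eq]
    ext v
    rw [← hA.coeff_zero ![]]
    simp [FormalMultilinearSeries.shift]
  · have h1 := hP.eventually_hasSum
    have h2 := hU.eventually_hasSum
    filter_upwards [h1, h2] with w hw1 hw2
    simpa using hw1.unique hw2

/-- The ideal generated by the components of `B z (X z)`, with `B` an analytic family of linear
maps, is contained in the ideal generated by the components of `X`. -/
theorem idealOfFuns_le_of_eventually_clm_apply {n p : ℕ} {X Y : Fin p → Cn n → ℂ}
    (hX : ∀ i, AnalyticAt ℂ (X i) 0) {B : Cn n → (Fin p → ℂ) →L[ℂ] (Fin p → ℂ)}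
    (hB : AnalyticAt ℂ B 0)
    (hY : ∀ᶠ z in 𝓝 0, (fun i => Y i z) = B z fun i => X i z) :
    idealOfFuns (Set.range Y) ≤ idealOfFuns (Set.range X) := by
  refine Ideal.span_le.2 ?_
  rintro y ⟨_, ⟨i, rfl⟩, hy⟩
  have hb : ∀ j, AnalyticAt ℂ (fun z => B z (Pi.single j 1) i) 0 := fun j =>
    ((ContinuousLinearMap.proj (R := ℂ) (φ := fun _ : Fin p => ℂ) i).comp
      (ContinuousLinearMap.apply ℂ (Fin p → ℂ)
        (Pi.single j 1 : Fin p → ℂ))).analyticAt _ |>.comp hB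
  let b : Fin p → On n := fun j => ⟨_, _, hb j, rfl⟩
  let x : Fin p → On n := fun j => ⟨_, _, hX j, rfl⟩
  have hsum : y = ∑ j, b j * x j := by
    apply Subtype.ext
    have hcoe : ((∑ j, b j * x j : On n) : Germ (𝓝 (0 : Cn n)) ℂ)
        = ((∑ j, (fun z => B z (Pi.single j 1) i) * X j : Cn n → ℂ) :
          Germ (𝓝 (0 : Cn n)) ℂ) := by
      rw [AddSubmonoidClass.coe_finsetSum]
      exact (map_sum (Germ.coeRingHom (R := ℂ) (𝓝 (0 : Cn n))) _ _).symm
    rw [hcoe, hy]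
    refine Germ.coe_eq.2 ?_
    filter_upwards [hY] with z hz
    have := congrFun hz i
    rw [this, pi_eq_sum_univ' (fun i => X i z), map_sum]
    simp [Finset.sum_apply, mul_comm]
  rw [hsum]
  exact Ideal.sum_mem _ fun j _ =>
    Ideal.mul_mem_left _ _ (Ideal.subset_span ⟨X j, ⟨j, rfl⟩, rfl⟩)

/-- The components of `X` and of `B z (X z)` generate the same ideal when `B` is an analytic family
of linear maps which is invertible at `0`. -/
theorem idealOfFuns_eq_of_eventually_clm_apply {n p : ℕ} {X Y : Fin p → Cn n → ℂ}
    (hX : ∀ i, AnalyticAt ℂ (X i) 0) (hY : ∀ i, AnalyticAt ℂ (Y i) 0)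
    {B : Cn n → (Fin p → ℂ) →L[ℂ] (Fin p → ℂ)} (hB : AnalyticAt ℂ B 0) (hB0 : IsUnit (B 0))
    (hXY : ∀ᶠ z in 𝓝 0, (fun i => Y i z) = B z fun i => X i z) :
    idealOfFuns (Set.range Y) = idealOfFuns (Set.range X) := by
  refine le_antisymm (idealOfFuns_le_of_eventually_clm_apply hX hB hXY) ?_
  have hinv : AnalyticAt ℂ (fun z => Ring.inverse (B z)) 0 := by
    obtain ⟨u, hu⟩ := hB0
    have := analyticAt_inverse (𝕜 := ℂ) u
    rw [hu] at this
    exact this.comp hB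
  refine idealOfFuns_le_of_eventually_clm_apply hY hinv ?_
  filter_upwards [hXY, hB.continuousAt (Units.isOpen.mem_nhds hB0)] with z hz hu
  rw [hz, ← mul_apply_eq_comp, Ring.inverse_mul_cancel _ hu,
    one_apply_eq_self]

/-- The assertion underlying **Corollary 3.7**: if `h` has a Morse singularity
at the origin of `ℂ^p` and `G = (g₁, …, g_p)` with `gᵢ(0) = 0`, then
`G*(J(h))O_n = I`, i.e. the ideal of `O_n` generated by the germs of the
pullbacks `(∂h/∂wᵢ) ∘ G` equals the ideal generated by the germs of the `gᵢ`. -/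
theorem corollary_3_7_key (n p : ℕ) (hp : 1 ≤ p)
    (h : (Fin p → ℂ) → ℂ) (hh : AnalyticAt ℂ h 0) (hh0 : h 0 = 0)
    (hdh : fderiv ℂ h 0 = 0)
    (hhess : (Matrix.of fun i j : Fin p =>
      fderiv ℂ (fun w => fderiv ℂ h w (Pi.single j 1)) 0 (Pi.single i 1)).det ≠ 0)
    (g : Fin p → Cn n → ℂ) (hg : ∀ i, AnalyticAt ℂ (g i) 0)
    (hg0 : ∀ i, g i 0 = 0)
    (G : Cn n → (Fin p → ℂ)) (hG : G = fun z i => g i z) :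
    idealOfFuns (Set.range fun i : Fin p =>
        fun z => fderiv ℂ h (G z) (Pi.single i 1))
      = idealOfFuns (Set.range g) := by
  set F : (Fin p → ℂ) → Fin p → ℂ := fun w i => fderiv ℂ h w (Pi.single i 1) with hF
  have hFi : ∀ i, AnalyticAt ℂ (fun w => F w i) 0 := fun i =>
    (ContinuousLinearMap.apply ℂ ℂ (Pi.single i (1 : ℂ) : Fin p → ℂ)).analyticAt _ |>.comp hh.fderiv
  have hFan : AnalyticAt ℂ F 0 := analyticAt_pi_iff.2 hFi
  have hF0 : F 0 = 0 := by
    ext i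
    simp [hF, hdh]
  obtain ⟨A, hA, hA0, hFA⟩ := hFan.exists_eventually_eq_add_clm_apply
  have hGan : AnalyticAt ℂ G 0 := by
    rw [hG]
    exact analyticAt_pi_iff.2 hg
  have hG0 : G 0 = 0 := by
    ext i
    simp [hG, hg0]
  have hunit : IsUnit (A 0) := by
    rw [ContinuousLinearMap.isUnit_iff_isUnit_toLinearMap, LinearMap.isUnit_iff_isUnit_det,
      isUnit_iff_ne_zero, ← LinearMap.det_toMatrix', ← Matrix.det_transpose]
    convert hhess using 2
    ext i j
    rw [Matrix.transpose_apply, LinearMap.toMatrix'_apply, hA0, Matrix.of_apply]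
    have hpi := (hasFDerivAt_pi'.1 hFan.differentiableAt.hasFDerivAt j).fderiv
    change fderiv ℂ F 0 _ j = fderiv ℂ (fun w => F w j) 0 _
    rw [hpi]
    simp [Pi.single]
  have hA' : AnalyticAt ℂ A (G 0) := hG0 ▸ hA
  have hF' : ∀ i, AnalyticAt ℂ (fun w => F w i) (G 0) := hG0 ▸ hFi
  refine idealOfFuns_eq_of_eventually_clm_apply (B := fun z => A (G z)) hg
    (fun i => (hF' i).comp hGan) (hA'.comp hGan) (by simpa only [hG0] using hunit) ?_
  have ht : Tendsto G (𝓝 0) (𝓝 0) := by simpa only [hG0] using hGan.continuousAt.tendsto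
  filter_upwards [ht.eventually hFA] with z hz
  rw [hF0, zero_add] at hz
  rw [hG] at hz ⊢
  exact hz

end
end
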